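/- arXiv:math/9201229 — 2 statements merged into one kernel-verified Lean document; each statement's English description precedes it below -/
import Mathlib

section
/- Let H be a Hilbert space, 0 < p₀ ≤ p₁ ≤ ∞, and x ∈ C_{p₀} + C_{p₁}. Then for all t > 0, K_t(x, C_{p₀}, C_{p₁}) = K_t(|x|, C_{p₀}, C_{p₁}) = K_t(λ(|x|), ℓ_{p₀}, ℓ_{p₁}), where λ(|x|) is the nonincreasing sequence of eigenvalues of |x| = (x*x)^{1/2} (with multiplicity). -/
noncomputable section

open MeasureTheory
open scoped ENNReal NNReal

variable {H : Type*} [NormedAddCommGroup H] [InnerProductSpace ℂ H] [CompleteSpace H]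

/-- The `n`-th approximation (= singular) number of a bounded operator `x` on a Hilbert space:
the distance from `x` to the operators of rank at most `n`.  For a compact operator `x` this is
the `n`-th eigenvalue `λ_n(|x|)` of `|x|` arranged in nonincreasing order with multiplicity. -/
def singNum (x : H →L[ℂ] H) (n : ℕ) : ℝ :=
  sInf {c : ℝ | ∃ F : H →L[ℂ] H,
    FiniteDimensional ℂ (LinearMap.range (F : H →ₗ[ℂ] H)) ∧
    Module.finrank ℂ (LinearMap.range (F : H →ₗ[ℂ] H)) ≤ n ∧ c = ‖x - F‖}

/-- The Schatten `p`-(quasi)norm of an operator, `(∑ λ_n(|x|)^p)^{1/p}` (for `p = ∞`, the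
largest singular number, i.e. the operator norm), expressed as the `ℓ_p`-norm of the sequence of
singular numbers. -/
def schattenNorm (p : ℝ≥0∞) (x : H →L[ℂ] H) : ℝ≥0∞ :=
  eLpNorm (singNum x) p Measure.count

/-- The modulus `|x| = (x* x)^{1/2}` of an operator, via the continuous functional calculus. -/
def absCLM (x : H →L[ℂ] H) : H →L[ℂ] H := cfc Real.sqrt (star x * x)

/-- The K-functional of the couple of Schatten classes `(C_{p₀}, C_{p₁})`. -/
def Kschatten (t : ℝ) (p₀ p₁ : ℝ≥0∞) (x : H →L[ℂ] H) : ℝ≥0∞ :=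
  sInf {c : ℝ≥0∞ | ∃ x₀ x₁ : H →L[ℂ] H, x = x₀ + x₁ ∧
    IsCompactOperator (⇑x₀) ∧ IsCompactOperator (⇑x₁) ∧
    c = schattenNorm p₀ x₀ + ENNReal.ofReal t * schattenNorm p₁ x₁}

/-- The K-functional of the couple of sequence spaces `(ℓ_{p₀}, ℓ_{p₁})`. -/
def Kseq (t : ℝ) (p₀ p₁ : ℝ≥0∞) (a : ℕ → ℝ) : ℝ≥0∞ :=
  sInf {c : ℝ≥0∞ | ∃ b₀ b₁ : ℕ → ℝ, a = b₀ + b₁ ∧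
    c = eLpNorm b₀ p₀ Measure.count + ENNReal.ofReal t * eLpNorm b₁ p₁ Measure.count}

set_option linter.unusedSectionVars false
set_option linter.deprecated false

/-- Rank-one positive operator. -/
abbrev rOne (u : H) : H →L[ℂ] H := InnerProductSpace.rankOne ℂ u u

/-- orthogonal families whose members are unit vectors or zero. -/
structure OZ (g : ℕ → H) : Prop where
  orth : ∀ n m, n ≠ m → inner ℂ (g n) (g m) = 0
  unit : ∀ n, ‖g n‖ = 1 ∨ g n = 0

lemma OZ.norm_le {g : ℕ → H} (hg : OZ g) (n : ℕ) : ‖g n‖ ≤ 1 := by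
  rcases hg.unit n with h | h <;> simp [h]

lemma OZ.bessel {g : ℕ → H} (hg : OZ g) (F : Finset ℕ) (v : H) :
    ∑ n ∈ F, ‖inner ℂ (g n) v‖ ^ 2 ≤ ‖v‖ ^ 2 := by
  classical
  have ho : Orthonormal ℂ (fun n : {n // g n ≠ 0} => g n) := by
    constructor
    · intro n; exact (hg.unit n).resolve_right n.2
    · intro n m hnm; exact hg.orth _ _ (fun h => hnm (Subtype.ext h))
  have h1 : ∑ n ∈ F, ‖inner ℂ (g n) v‖ ^ 2
      = ∑ n ∈ F.subtype (fun n => g n ≠ 0), ‖inner ℂ (g n) v‖ ^ 2 := by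
    rw [Finset.sum_subtype_eq_sum_filter (p := fun n => g n ≠ 0) (f := fun n => ‖inner ℂ (g n) v‖ ^ 2),
      Finset.sum_filter]
    refine Finset.sum_congr rfl fun n _ => ?_
    by_cases h : g n = 0 <;> simp [h]
  rw [h1]
  exact ho.sum_inner_products_le v

lemma OZ.norm_sum_sq {g : ℕ → H} (hg : OZ g) (F : Finset ℕ) (c : ℕ → ℂ) :
    ‖∑ n ∈ F, c n • g n‖ ^ 2 = ∑ n ∈ F, ‖c n‖ ^ 2 * ‖g n‖ ^ 2 := by
  classical
  induction F using Finset.induction_on with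
  | empty => simp
  | insert a F ha ih =>
    rw [Finset.sum_insert ha, Finset.sum_insert ha, ← ih]
    have h0 : inner ℂ (c a • g a) (∑ n ∈ F, c n • g n) = 0 := by
      rw [inner_sum]
      refine Finset.sum_eq_zero fun n hn => ?_
      rw [inner_smul_left, inner_smul_right, hg.orth a n (fun h => ha (h ▸ hn))]
      simp
    have := norm_add_sq_eq_norm_sq_add_norm_sq_of_inner_eq_zero _ _ h0
    rw [pow_two, this, norm_smul]
    ring

lemma OZ.norm_sum_sq_le {g : ℕ → H} (hg : OZ g) (F : Finset ℕ) (c : ℕ → ℂ) :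
    ‖∑ n ∈ F, c n • g n‖ ^ 2 ≤ ∑ n ∈ F, ‖c n‖ ^ 2 := by
  rw [hg.norm_sum_sq]
  refine Finset.sum_le_sum fun n _ => ?_
  have := hg.norm_le n
  have h2 : ‖g n‖ ^ 2 ≤ 1 := pow_le_one₀ (norm_nonneg _) this
  nlinarith [sq_nonneg ‖c n‖]

lemma OZ.diag_bound {g : ℕ → H} (hg : OZ g) (F : Finset ℕ) (b : ℕ → ℝ) (c : ℝ) (hc : 0 ≤ c)
    (hb : ∀ n ∈ F, |b n| ≤ c) : ‖∑ n ∈ F, (b n : ℂ) • rOne (g n)‖ ≤ c := by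
  refine ContinuousLinearMap.opNorm_le_bound _ hc fun v => ?_
  have h1 : (∑ n ∈ F, (b n : ℂ) • rOne (g n)) v = ∑ n ∈ F, ((b n : ℂ) * inner ℂ (g n) v) • g n := by
    simp only [ContinuousLinearMap.sum_apply, ContinuousLinearMap.smul_apply, InnerProductSpace.rankOne_apply, smul_smul]
  rw [h1]
  have h2 := hg.norm_sum_sq_le F (fun n => (b n : ℂ) * inner ℂ (g n) v)
  have h3 : ∑ n ∈ F, ‖(b n : ℂ) * inner ℂ (g n) v‖ ^ 2 ≤ c ^ 2 * ‖v‖ ^ 2 := by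
    refine le_trans ?_ (mul_le_mul_of_nonneg_left (hg.bessel F v) (sq_nonneg c))
    rw [Finset.mul_sum]
    refine Finset.sum_le_sum fun n hn => ?_
    rw [norm_mul, mul_pow]
    gcongr
    simpa using hb n hn
  refine abs_le_of_sq_le_sq' ?_ (by positivity) |>.2
  rw [mul_pow]; exact h2.trans h3

/-! ### singular numbers -/

lemma singNum_le (x F : H →L[ℂ] H) (n : ℕ)
    (h1 : FiniteDimensional ℂ (LinearMap.range (F : H →ₗ[ℂ] H)))
    (h2 : Module.finrank ℂ (LinearMap.range (F : H →ₗ[ℂ] H)) ≤ n) : singNum x n ≤ ‖x - F‖ :=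
  csInf_le ⟨0, by rintro _ ⟨F, _, _, rfl⟩; exact norm_nonneg _⟩ ⟨F, h1, h2, rfl⟩

lemma le_singNum (x : H →L[ℂ] H) (n : ℕ) (c : ℝ)
    (h : ∀ F : H →L[ℂ] H, FiniteDimensional ℂ (LinearMap.range (F : H →ₗ[ℂ] H)) →
      Module.finrank ℂ (LinearMap.range (F : H →ₗ[ℂ] H)) ≤ n → c ≤ ‖x - F‖) : c ≤ singNum x n := by
  have hz : LinearMap.range ((0 : H →L[ℂ] H) : H →ₗ[ℂ] H) = ⊥ := LinearMap.range_eq_bot.2 rfl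
  refine le_csInf ⟨‖x - 0‖, 0, ?_, ?_, rfl⟩ ?_
  · rw [hz]; infer_instance
  · rw [hz]; simp
  · rintro _ ⟨F, h1, h2, rfl⟩; exact h F h1 h2

lemma singNum_nonneg (x : H →L[ℂ] H) (n : ℕ) : 0 ≤ singNum x n :=
  le_singNum _ _ _ fun _ _ _ => norm_nonneg _

lemma singNum_antitone (x : H →L[ℂ] H) : Antitone (singNum x) := fun _ _ hnm =>
  le_singNum _ _ _ fun F h1 h2 => singNum_le x F _ h1 (h2.trans hnm)

lemma singNum_comp_le (U y : H →L[ℂ] H) (hU : ‖U‖ ≤ 1) (n : ℕ) :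
    singNum (U * y) n ≤ singNum y n := by
  refine le_singNum _ _ _ fun F h1 h2 => ?_
  have hr : LinearMap.range ((U * F : H →L[ℂ] H) : H →ₗ[ℂ] H)
      = (LinearMap.range (F : H →ₗ[ℂ] H)).map (U : H →ₗ[ℂ] H) := by
    rw [← LinearMap.range_comp]; rfl
  have h3 : FiniteDimensional ℂ (LinearMap.range ((U * F : H →L[ℂ] H) : H →ₗ[ℂ] H)) := by
    rw [hr]; infer_instance
  have h4 : Module.finrank ℂ (LinearMap.range ((U * F : H →L[ℂ] H) : H →ₗ[ℂ] H)) ≤ n := by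
    rw [hr]; exact (Submodule.finrank_map_le _ _).trans h2
  refine (singNum_le _ (U * F) n h3 h4).trans ?_
  rw [← mul_sub]
  refine (norm_mul_le _ _).trans ?_
  nlinarith [norm_nonneg (y - F)]

lemma singNum_add_smul_one (T : H →L[ℂ] H) (c : ℝ) (hc : 0 ≤ c) (n : ℕ) :
    singNum (T + (c : ℂ) • (1 : H →L[ℂ] H)) n ≤ singNum T n + c := by
  rw [← sub_le_iff_le_add]
  refine le_singNum _ _ _ fun F h1 h2 => ?_
  rw [sub_le_iff_le_add]
  refine (singNum_le _ F n h1 h2).trans ?_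
  rw [add_sub_right_comm]
  refine (norm_add_le _ _).trans ?_
  gcongr
  refine ContinuousLinearMap.opNorm_le_bound _ hc fun v => ?_
  simp [norm_smul, abs_of_nonneg hc]

lemma finDim_sum (g : ℕ → H) (F : Finset ℕ) (b : ℕ → ℝ) :
    FiniteDimensional ℂ (LinearMap.range ((∑ n ∈ F, (b n : ℂ) • rOne (g n) : H →L[ℂ] H) : H →ₗ[ℂ] H)) ∧
    Module.finrank ℂ (LinearMap.range ((∑ n ∈ F, (b n : ℂ) • rOne (g n) : H →L[ℂ] H) : H →ₗ[ℂ] H))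
      ≤ F.card := by
  classical
  have hle : LinearMap.range ((∑ n ∈ F, (b n : ℂ) • rOne (g n) : H →L[ℂ] H) : H →ₗ[ℂ] H)
      ≤ Submodule.span ℂ ((F.image g : Finset H) : Set H) := by
    rintro _ ⟨v, rfl⟩
    simp only [ContinuousLinearMap.coe_coe, ContinuousLinearMap.sum_apply,
      ContinuousLinearMap.smul_apply, InnerProductSpace.rankOne_apply]
    refine Submodule.sum_mem _ fun n hn => Submodule.smul_mem _ _ (Submodule.smul_mem _ _ ?_)
    exact Submodule.subset_span (by simpa using ⟨n, hn, rfl⟩)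
  have hfd : FiniteDimensional ℂ (Submodule.span ℂ ((F.image g : Finset H) : Set H)) :=
    FiniteDimensional.span_finset ℂ _
  refine ⟨Submodule.finiteDimensional_of_le hle, ?_⟩
  exact (Submodule.finrank_mono hle).trans ((finrank_span_finset_le_card _).trans Finset.card_image_le)

/-- A vector in the span of `n+1` orthonormal vectors killed by an operator of rank `≤ n`. -/
lemma exists_ker_vec (g : ℕ → H) (hg : OZ g) (n : ℕ) (h1 : ∀ k ≤ n, ‖g k‖ = 1) (F : H →L[ℂ] H)
    (hF : FiniteDimensional ℂ (LinearMap.range (F : H →ₗ[ℂ] H)))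
    (hr : Module.finrank ℂ (LinearMap.range (F : H →ₗ[ℂ] H)) ≤ n) :
    ∃ c : ℕ → ℂ, F (∑ k ∈ Finset.range (n + 1), c k • g k) = 0 ∧
      ‖∑ k ∈ Finset.range (n + 1), c k • g k‖ = 1 := by
  let L : (Fin (n + 1) → ℂ) →ₗ[ℂ] LinearMap.range (F : H →ₗ[ℂ] H) :=
    (F : H →ₗ[ℂ] H).rangeRestrict ∘ₗ Fintype.linearCombination ℂ (fun k : Fin (n + 1) => g k)
  have hker : LinearMap.ker L ≠ ⊥ := by
    apply LinearMap.ker_ne_bot_of_finrank_lt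
    simpa using Nat.lt_succ_of_le hr
  obtain ⟨d, hd, hd0⟩ := (Submodule.ne_bot_iff _).1 hker
  set c : ℕ → ℂ := fun k => if h : k < n + 1 then d ⟨k, h⟩ else 0 with hc
  have hs : ∑ k ∈ Finset.range (n + 1), c k • g k = ∑ k : Fin (n + 1), d k • g k := by
    rw [Finset.sum_range]
    refine Finset.sum_congr rfl fun k _ => ?_
    have hk : (k : ℕ) < n + 1 := k.2
    simp only [hc, dif_pos hk]
  have hFs : F (∑ k ∈ Finset.range (n + 1), c k • g k) = 0 := by
    rw [hs]
    have := congrArg Subtype.val (LinearMap.mem_ker.1 hd)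
    simpa [L, Fintype.linearCombination_apply] using this
  have hne : ‖∑ k ∈ Finset.range (n + 1), c k • g k‖ ≠ 0 := by
    intro h
    have h2 := hg.norm_sum_sq (Finset.range (n + 1)) c
    rw [h] at h2
    have h3 := (Finset.sum_eq_zero_iff_of_nonneg (fun k _ => by positivity)).1
      (h2.symm.trans (by norm_num))
    apply hd0
    ext k
    have hk : (k : ℕ) < n + 1 := k.2
    have h4 := h3 (k : ℕ) (Finset.mem_range.2 hk)
    rw [h1 k (Nat.le_of_lt_succ hk)] at h4
    simp only [hc, dif_pos hk] at h4
    simpa using h4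
  set w := ∑ k ∈ Finset.range (n + 1), c k • g k with hw
  refine ⟨fun k => ((‖w‖⁻¹ : ℝ) : ℂ) * c k, ?_⟩
  have hs2 : ∑ k ∈ Finset.range (n + 1), (((‖w‖⁻¹ : ℝ) : ℂ) * c k) • g k = ((‖w‖⁻¹ : ℝ) : ℂ) • w := by
    rw [hw, Finset.smul_sum]
    simp [smul_smul]
  rw [hs2]
  constructor
  · rw [map_smul, hFs, smul_zero]
  · rw [norm_smul]; simp [hne]

open Filter Topology

lemma exists_top (T : H →L[ℂ] H) (hp : T.IsPositive) (hc : IsCompactOperator (⇑T)) :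
    ∃ u : H, (T ≠ 0 → ‖u‖ = 1) ∧ (T = 0 → u = 0) ∧ T u = (‖T‖ : ℂ) • u := by
  by_cases h0 : T = 0
  · exact ⟨0, fun h => (h h0).elim, fun _ => rfl, by simp⟩
  have hnt : Nontrivial H := by
    by_contra hn
    rw [not_nontrivial_iff_subsingleton] at hn
    exact h0 (ContinuousLinearMap.ext fun v => Subsingleton.elim _ _)
  have h1 : ‖T‖ ∈ spectrum ℝ T :=
    CStarAlgebra.norm_mem_spectrum_of_nonneg (ha := (ContinuousLinearMap.nonneg_iff_isPositive T).2 hp)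
  have h2 : (‖T‖ : ℂ) ∈ spectrum ℂ T := by
    have := (spectrum.algebraMap_mem_iff ℂ (R := ℝ) (a := T) (r := ‖T‖)).2 h1
    simpa using this
  have h3 : Module.End.HasEigenvalue (T : Module.End ℂ H) (‖T‖ : ℂ) :=
    (hc.hasEigenvalue_iff_mem_spectrum (by simpa using h0)).2 h2
  obtain ⟨v, hv⟩ := h3.exists_hasEigenvector
  have hv0 : ‖v‖ ≠ 0 := norm_ne_zero_iff.2 hv.2
  have hTv : T v = (‖T‖ : ℂ) • v := hv.apply_eq_smul
  refine ⟨((‖v‖⁻¹ : ℝ) : ℂ) • v, fun _ => ?_, fun h => (h0 h).elim, ?_⟩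
  · rw [norm_smul]; simp [hv0]
  · rw [map_smul, hTv, smul_comm]

lemma IsPositive.inner_symm {T : H →L[ℂ] H} (hp : T.IsPositive) (v w : H) :
    inner ℂ (T v) w = inner ℂ v (T w) := hp.isSymmetric v w

lemma rOne_compact (u : H) : IsCompactOperator (⇑(rOne u)) := by
  have h : IsCompactOperator (id : ℂ → ℂ) :=
    (isCompactOperator_id_iff_finiteDimensional (𝕜 := ℂ)).2 inferInstance
  exact (h.clm_comp (ContinuousLinearMap.toSpanSingleton ℂ u)).comp_clm (innerSL ℂ u)

/-- one greedy step -/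
lemma step_props (T : H →L[ℂ] H) (hp : T.IsPositive) (hc : IsCompactOperator (⇑T)) (u : H)
    (h1 : T ≠ 0 → ‖u‖ = 1) (h0 : T = 0 → u = 0) (hu : T u = (‖T‖ : ℂ) • u) :
    (T - (‖T‖ : ℂ) • rOne u).IsPositive ∧ IsCompactOperator (⇑(T - (‖T‖ : ℂ) • rOne u)) ∧
    ‖T - (‖T‖ : ℂ) • rOne u‖ ≤ ‖T‖ ∧ (T - (‖T‖ : ℂ) • rOne u) u = 0 := by
  by_cases hT : T = 0
  · subst hT
    have := h0 rfl
    subst this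
    refine ⟨?_, ?_, ?_, ?_⟩
    · simpa using ContinuousLinearMap.isPositive_zero
    · simpa using hc
    · simp
    · simp
  have hu1 := h1 hT
  have key : ∀ v, inner ℂ u (T v) = (‖T‖ : ℂ) * inner ℂ u v := by
    intro v
    rw [← IsPositive.inner_symm hp, hu, inner_smul_left]; simp
  have hnsq : inner ℂ u u = (1 : ℂ) := by
    rw [inner_self_eq_norm_sq_to_K, hu1]; simp
  have hval : ∀ v, (T - (‖T‖ : ℂ) • rOne u) v = T (v - inner ℂ u v • u) := by
    intro v
    simp only [ContinuousLinearMap.sub_apply, ContinuousLinearMap.smul_apply,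
      InnerProductSpace.rankOne_apply, map_sub, map_smul, hu]
    rw [smul_comm]
  have hval2 : ∀ v, inner ℂ ((T - (‖T‖ : ℂ) • rOne u) v) v
      = inner ℂ (T (v - inner ℂ u v • u)) (v - inner ℂ u v • u) := by
    intro v
    have h0 : inner ℂ (T (v - inner ℂ u v • u)) u = 0 := by
      rw [← inner_conj_symm, key, inner_sub_right, inner_smul_right, hnsq]; simp
    rw [hval, inner_sub_right (T (v - inner ℂ u v • u)) v, inner_smul_right, h0,
      mul_zero, sub_zero]
  refine ⟨?_, ?_, ?_, ?_⟩
  · rw [ContinuousLinearMap.isPositive_iff_complex]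
    intro v
    rw [hval2]
    exact (ContinuousLinearMap.isPositive_iff_complex T).1 hp _
  · exact hc.sub ((rOne_compact u).smul (‖T‖ : ℂ))
  · refine ContinuousLinearMap.opNorm_le_bound _ (norm_nonneg _) fun v => ?_
    rw [hval]
    refine (T.le_opNorm _).trans ?_
    gcongr
    have h3 : inner ℂ (v - inner ℂ u v • u) (inner ℂ u v • u) = (0 : ℂ) := by
      rw [inner_smul_right, ← inner_conj_symm (v - inner ℂ u v • u) u, inner_sub_right, inner_smul_right, hnsq]; simp
    have h4 := norm_add_sq_eq_norm_sq_add_norm_sq_of_inner_eq_zero _ _ h3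
    rw [sub_add_cancel] at h4
    nlinarith [norm_nonneg v, norm_nonneg (v - inner ℂ u v • u), norm_nonneg (inner ℂ u v • u)]
  · rw [hval, hnsq]; simp

structure Spec (A : H →L[ℂ] H) (g : ℕ → H) : Prop where
  oz : OZ g
  unit : ∀ n, singNum A n ≠ 0 → ‖g n‖ = 1
  zero : ∀ n, singNum A n = 0 → g n = 0
  eig : ∀ n, A (g n) = (singNum A n : ℂ) • g n
  tend : Tendsto (singNum A) atTop (𝓝 0)
  hasSum : HasSum (fun n => (singNum A n : ℂ) • rOne (g n)) A

lemma greedy (A : H →L[ℂ] H) (hp : A.IsPositive) (hc : IsCompactOperator (⇑A)) :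
    ∃ (T : ℕ → H →L[ℂ] H) (g : ℕ → H), T 0 = A ∧ (∀ n, (T n).IsPositive) ∧
      (∀ n, T (n + 1) = T n - (‖T n‖ : ℂ) • rOne (g n)) ∧
      (∀ n, T n ≠ 0 → ‖g n‖ = 1) ∧ (∀ n, T n = 0 → g n = 0) ∧
      (∀ n, T n (g n) = (‖T n‖ : ℂ) • g n) ∧ (∀ n, ‖T (n + 1)‖ ≤ ‖T n‖) ∧
      (∀ n, T (n + 1) (g n) = 0) := by
  let S := {T : H →L[ℂ] H // T.IsPositive ∧ IsCompactOperator (⇑T)}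
  have hch : ∀ T : S, ∃ u : H, (T.1 ≠ 0 → ‖u‖ = 1) ∧ (T.1 = 0 → u = 0) ∧ T.1 u = (‖T.1‖ : ℂ) • u :=
    fun T => exists_top T.1 T.2.1 T.2.2
  choose top h1 h2 h3 using hch
  let nxt : S → S := fun T => ⟨T.1 - (‖T.1‖ : ℂ) • rOne (top T),
    (step_props T.1 T.2.1 T.2.2 (top T) (h1 T) (h2 T) (h3 T)).1,
    (step_props T.1 T.2.1 T.2.2 (top T) (h1 T) (h2 T) (h3 T)).2.1⟩
  let seq : ℕ → S := fun n => Nat.rec ⟨A, hp, hc⟩ (fun _ T => nxt T) n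
  refine ⟨fun n => (seq n).1, fun n => top (seq n), rfl, fun n => (seq n).2.1, fun n => rfl,
    fun n => h1 _, fun n => h2 _, fun n => h3 _, fun n => ?_, fun n => ?_⟩
  · exact (step_props (seq n).1 (seq n).2.1 (seq n).2.2 (top (seq n)) (h1 _) (h2 _) (h3 _)).2.2.1
  · exact (step_props (seq n).1 (seq n).2.1 (seq n).2.2 (top (seq n)) (h1 _) (h2 _) (h3 _)).2.2.2

lemma exists_spec (A : H →L[ℂ] H) (hp : A.IsPositive) (hc : IsCompactOperator (⇑A)) :
    ∃ g, Spec A g := by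
  obtain ⟨T, g, hT0, hTp, hTs, hg1, hg0, hTg, hTn, hTz⟩ := greedy A hp hc
  refine ⟨g, ?_⟩
  have hanti : Antitone (fun n => ‖T n‖) := antitone_nat_of_succ_le hTn
  -- kernels
  have hker : ∀ n m, n < m → T m (g n) = 0 := by
    intro n m hnm
    induction m, hnm using Nat.le_induction with
    | base => exact hTz n
    | succ m hm ih =>
      rw [hTs m]
      simp only [ContinuousLinearMap.sub_apply, ContinuousLinearMap.smul_apply,
        InnerProductSpace.rankOne_apply, ih]
      have : (‖T m‖ : ℂ) * inner ℂ (g m) (g n) = 0 := by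
        have h := IsPositive.inner_symm (hTp m) (g m) (g n)
        rw [hTg, inner_smul_left, ih] at h
        simpa using h
      rw [smul_smul, this]; simp
  have horth' : ∀ n m, n < m → inner ℂ (g m) (g n) = 0 := by
    intro n m hnm
    by_cases h : T m = 0
    · rw [hg0 m h]; simp
    have h2 := IsPositive.inner_symm (hTp m) (g m) (g n)
    rw [hTg, inner_smul_left, hker n m hnm] at h2
    simpa [h] using h2
  have hoz : OZ g := by
    constructor
    · intro n m hnm
      rcases lt_or_gt_of_ne hnm with h | h
      · rw [← inner_conj_symm, horth' n m h]; simp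
      · exact horth' m n h
    · intro n
      by_cases h : T n = 0
      · exact Or.inr (hg0 n h)
      · exact Or.inl (hg1 n h)
  have hsum : ∀ n, A = T n + ∑ k ∈ Finset.range n, (‖T k‖ : ℂ) • rOne (g k) := by
    intro n
    induction n with
    | zero => simp [hT0]
    | succ n ih => rw [Finset.sum_range_succ, hTs n]; nth_rewrite 1 [ih]; abel
  have heig : ∀ n, A (g n) = (‖T n‖ : ℂ) • g n := by
    intro n
    rw [hsum n]
    simp only [ContinuousLinearMap.add_apply, ContinuousLinearMap.sum_apply,
      ContinuousLinearMap.smul_apply, InnerProductSpace.rankOne_apply, hTg]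
    rw [Finset.sum_eq_zero, add_zero]
    intro k hk
    rw [hoz.orth k n (Finset.mem_range.1 hk).ne]; simp
  have hsn : ∀ n, singNum A n = ‖T n‖ := by
    intro n
    apply le_antisymm
    · have := singNum_le A _ n (finDim_sum g (Finset.range n) (fun k => ‖T k‖)).1
        ((finDim_sum g (Finset.range n) (fun k => ‖T k‖)).2.trans (by simp))
      nth_rewrite 2 [hsum n] at this
      simpa using this
    · by_cases hn : T n = 0
      · rw [hn, norm_zero]; exact singNum_nonneg _ _
      refine le_singNum _ _ _ fun F hF hr => ?_
      have hk1 : ∀ k ≤ n, ‖g k‖ = 1 := by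
        intro k hk
        apply hg1
        intro h
        have := hanti hk
        simp only [h, norm_zero] at this
        exact hn (norm_le_zero_iff.1 this)
      obtain ⟨c, hFc, hc1⟩ := exists_ker_vec g hoz n hk1 F hF hr
      set w := ∑ k ∈ Finset.range (n + 1), c k • g k with hw
      have h1 : (A - F) w = ∑ k ∈ Finset.range (n + 1), (c k * (‖T k‖ : ℂ)) • g k := by
        rw [ContinuousLinearMap.sub_apply, hFc, sub_zero, hw, map_sum]
        refine Finset.sum_congr rfl fun k _ => ?_
        rw [map_smul, heig, smul_smul]
      have h2 : ‖T n‖ ^ 2 ≤ ‖(A - F) w‖ ^ 2 := by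
        have h3 : ‖w‖ ^ 2 = 1 := by rw [hc1]; norm_num
        rw [hw, hoz.norm_sum_sq] at h3
        rw [h1, hoz.norm_sum_sq, ← mul_one (‖T n‖ ^ 2), ← h3, Finset.mul_sum]
        refine Finset.sum_le_sum fun k hk => ?_
        have : ‖T n‖ ≤ ‖T k‖ := hanti (Nat.le_of_lt_succ (Finset.mem_range.1 hk))
        have h5 : ‖T n‖ ^ 2 ≤ ‖T k‖ ^ 2 := by gcongr
        rw [norm_mul, mul_pow]
        simp only [Complex.norm_real, norm_norm]
        nlinarith [mul_nonneg (sq_nonneg ‖c k‖) (sq_nonneg ‖g k‖)]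
      have h6 := abs_le_of_sq_le_sq' h2 (norm_nonneg _) |>.2
      have h7 := (A - F).le_opNorm w
      rw [hc1, mul_one] at h7
      exact h6.trans h7
  have htend : Tendsto (fun n => ‖T n‖) atTop (𝓝 0) := by
    have h1 := tendsto_atTop_ciInf hanti ⟨0, by rintro _ ⟨n, rfl⟩; exact norm_nonneg _⟩
    set L := ⨅ n, ‖T n‖ with hL
    have hLn : ∀ n, L ≤ ‖T n‖ := fun n =>
      ciInf_le ⟨0, by rintro _ ⟨n, rfl⟩; exact norm_nonneg _⟩ n
    have hL0 : 0 ≤ L := le_ciInf fun n => norm_nonneg _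
    rcases hL0.eq_or_lt with h | h
    · rwa [← h] at h1
    exfalso
    have hne : ∀ n, ‖g n‖ = 1 := fun n => hg1 n fun h0 => by
      have := hLn n; rw [h0, norm_zero] at this; linarith
    obtain ⟨K, hK, hKs⟩ := IsCompactOperator.image_closedBall_subset_compact (f := (A : H →ₗ[ℂ] H)) hc 1
    obtain ⟨a, -, φ, hφ, hlim⟩ := hK.tendsto_subseq (x := fun n => A (g n))
      (fun n => hKs ⟨g n, by simp [hne n], rfl⟩)
    have hcau := hlim.cauchySeq
    rw [Metric.cauchySeq_iff] at hcau
    obtain ⟨N, hN⟩ := hcau L h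
    have h2 := hN N le_rfl (N + 1) (Nat.le_succ N)
    have hlt : φ N ≠ φ (N + 1) := (hφ (Nat.lt_succ_self N)).ne
    rw [dist_eq_norm] at h2
    simp only [Function.comp] at h2
    have h3 : inner ℂ (A (g (φ N))) (A (g (φ (N + 1)))) = 0 := by
      rw [heig, heig, inner_smul_left, inner_smul_right, hoz.orth _ _ hlt]; simp
    have h4 := norm_sub_sq (𝕜 := ℂ) (A (g (φ N))) (A (g (φ (N + 1))))
    rw [h3] at h4
    simp only [map_zero, mul_zero, sub_zero] at h4
    have h5 : ‖A (g (φ N))‖ = ‖T (φ N)‖ := by rw [heig, norm_smul, hne]; simp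
    have h6 := hLn (φ N)
    nlinarith [norm_nonneg (A (g (φ N)) - A (g (φ (N + 1)))), norm_nonneg (A (g (φ (N + 1))))]
  have hsf : singNum A = fun n => ‖T n‖ := funext hsn
  refine ⟨hoz, ?_, ?_, ?_, ?_, ?_⟩
  · intro n hn; rw [hsn] at hn; exact hg1 n (norm_ne_zero_iff.1 hn)
  · intro n hn; rw [hsn] at hn; exact hg0 n (norm_eq_zero.1 hn)
  · intro n; rw [hsn, heig]
  · rw [hsf]; exact htend
  · simp only [hsn]
    rw [HasSum, SummationFilter.unconditional_filter, Metric.tendsto_atTop]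
    intro ε hε
    obtain ⟨N, hN⟩ := (Metric.tendsto_atTop.1 htend) (ε / 2) (by positivity)
    refine ⟨Finset.range N, fun F hF => ?_⟩
    have hNN := hN N le_rfl
    simp only [dist_zero_right, norm_norm] at hNN
    rw [dist_comm, dist_eq_norm]
    have h1 : A - ∑ b ∈ F, (‖T b‖ : ℂ) • rOne (g b)
        = T N - ∑ b ∈ F \ Finset.range N, (‖T b‖ : ℂ) • rOne (g b) := by
      rw [← Finset.sum_sdiff hF]
      nth_rewrite 1 [hsum N]
      abel
    have h2 := hoz.diag_bound (F \ Finset.range N) (fun b => ‖T b‖) ‖T N‖ (norm_nonneg _) (by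
      intro n hn
      simp only [Finset.mem_sdiff, Finset.mem_range, not_lt] at hn
      rw [abs_of_nonneg (norm_nonneg _)]
      exact hanti hn.2)
    rw [h1]
    refine (norm_sub_le _ _).trans_lt ?_
    linarith

lemma inner_diag (g : ℕ → H) (b : ℕ → ℝ) (n : ℕ) (v : H) :
    (inner ℂ (((b n : ℂ) • rOne (g n)) v) v).re = b n * ‖inner ℂ (g n) v‖ ^ 2 := by
  simp only [ContinuousLinearMap.smul_apply, InnerProductSpace.rankOne_apply, smul_smul]
  rw [inner_smul_left, map_mul, mul_assoc]
  rw [mul_comm ((starRingEnd ℂ) (inner ℂ (g n) v)), Complex.mul_conj, Complex.normSq_eq_norm_sq]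
  simp only [Complex.conj_ofReal]
  rw [← Complex.ofReal_mul, Complex.ofReal_re]

lemma diag_form {g : ℕ → H} {b : ℕ → ℝ} {X : H →L[ℂ] H}
    (h : HasSum (fun n => (b n : ℂ) • rOne (g n)) X) (v : H) :
    HasSum (fun n => b n * ‖inner ℂ (g n) v‖ ^ 2) (inner ℂ (X v) v).re := by
  let L : (H →L[ℂ] H) →+ ℝ :=
    { toFun := fun T => (inner ℂ (T v) v).re
      map_zero' := by simp
      map_add' := fun S T => by simp [inner_add_left] }
  have hL : Continuous L := by
    change Continuous fun T : H →L[ℂ] H => (inner ℂ (T v) v).re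
    fun_prop
  have := h.map L hL
  have he : (L ∘ fun n => (b n : ℂ) • rOne (g n)) = fun n => b n * ‖inner ℂ (g n) v‖ ^ 2 :=
    funext fun n => inner_diag g b n v
  rw [he] at this
  exact this

lemma Spec.form {A : H →L[ℂ] H} {g : ℕ → H} (h : Spec A g) (v : H) :
    HasSum (fun n => singNum A n * ‖inner ℂ (g n) v‖ ^ 2) (inner ℂ (A v) v).re :=
  diag_form h.hasSum v

lemma OZ.inner_sum {g : ℕ → H} (hg : OZ g) (F : Finset ℕ) (c : ℕ → ℂ) (k : ℕ) (hk : k ∈ F)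
    (h1 : ‖g k‖ = 1) : inner ℂ (g k) (∑ j ∈ F, c j • g j) = c k := by
  rw [_root_.inner_sum, Finset.sum_eq_single k]
  · rw [inner_smul_right, inner_self_eq_norm_sq_to_K, h1]; simp
  · intro j _ hj
    rw [inner_smul_right, hg.orth k j hj.symm, mul_zero]
  · intro h; exact (h hk).elim

lemma Spec.le_of_form {A : H →L[ℂ] H} {g : ℕ → H} (h : Spec A g) (T : H →L[ℂ] H) (n : ℕ)
    (hT : ∀ c : ℕ → ℂ, ∀ v, v = ∑ k ∈ Finset.range (n + 1), c k • g k →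
      (inner ℂ (A v) v).re ≤ (inner ℂ (T v) v).re) :
    singNum A n ≤ singNum T n := by
  by_cases hn : singNum A n = 0
  · rw [hn]; exact singNum_nonneg _ _
  have hpos : 0 < singNum A n := lt_of_le_of_ne (singNum_nonneg _ _) (Ne.symm hn)
  have hk1 : ∀ k ≤ n, ‖g k‖ = 1 := fun k hk =>
    h.unit k (lt_of_lt_of_le hpos (singNum_antitone A hk)).ne'
  refine le_singNum _ _ _ fun F hF hr => ?_
  obtain ⟨c, hFc, hc1⟩ := exists_ker_vec g h.oz n hk1 F hF hr
  have hT' := hT c _ rfl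
  set v := ∑ k ∈ Finset.range (n + 1), c k • g k with hv
  have h1 : singNum A n ≤ (inner ℂ (A v) v).re := by
    have h2 := sum_le_hasSum (Finset.range (n + 1))
      (fun i _ => mul_nonneg (singNum_nonneg A i) (sq_nonneg _)) (h.form v)
    refine le_trans ?_ h2
    have h3 : ‖v‖ ^ 2 = 1 := by rw [hc1]; norm_num
    rw [hv, h.oz.norm_sum_sq] at h3
    rw [← mul_one (singNum A n), ← h3, Finset.mul_sum]
    refine Finset.sum_le_sum fun k hk => ?_
    have hk' : k ≤ n := Nat.le_of_lt_succ (Finset.mem_range.1 hk)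
    rw [hv, h.oz.inner_sum _ c k hk (hk1 k hk'), hk1 k hk', one_pow, mul_one]
    exact mul_le_mul_of_nonneg_right (singNum_antitone A hk') (sq_nonneg _)
  have h2 : (inner ℂ (T v) v).re = (inner ℂ ((T - F) v) v).re := by
    rw [ContinuousLinearMap.sub_apply, hFc, sub_zero]
  calc singNum A n ≤ (inner ℂ ((T - F) v) v).re := h2 ▸ h1.trans hT'
    _ ≤ ‖(inner ℂ ((T - F) v) v)‖ := Complex.re_le_norm _
    _ ≤ ‖(T - F) v‖ * ‖v‖ := norm_inner_le_norm _ _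
    _ ≤ ‖T - F‖ := by
      have := (T - F).le_opNorm v
      rw [hc1] at this ⊢
      linarith

lemma Spec.trunc {A : H →L[ℂ] H} {g : ℕ → H} (h : Spec A g) (k : ℕ) (v : H) :
    (inner ℂ (A v) v).re ≤ ∑ j ∈ Finset.range k, (singNum A j - singNum A k) * ‖inner ℂ (g j) v‖ ^ 2
      + singNum A k * ‖v‖ ^ 2 := by
  refine hasSum_le_of_sum_le (h.form v) fun F => ?_
  have h1 : ∑ j ∈ F, singNum A j * ‖inner ℂ (g j) v‖ ^ 2
      ≤ ∑ j ∈ F, (if j < k then (singNum A j - singNum A k) * ‖inner ℂ (g j) v‖ ^ 2 else 0)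
        + singNum A k * ∑ j ∈ F, ‖inner ℂ (g j) v‖ ^ 2 := by
    rw [Finset.mul_sum, ← Finset.sum_add_distrib]
    refine Finset.sum_le_sum fun j _ => ?_
    split_ifs with hj
    · exact le_of_eq (by ring)
    · rw [zero_add]
      exact mul_le_mul_of_nonneg_right (singNum_antitone A (not_lt.1 hj)) (sq_nonneg _)
  refine h1.trans (add_le_add ?_ (mul_le_mul_of_nonneg_left (h.oz.bessel F v) (singNum_nonneg _ _)))
  rw [← Finset.sum_filter]
  refine Finset.sum_le_sum_of_subset_of_nonneg ?_ ?_
  · intro j hj; simp at hj; simpa using hj.2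
  · intro j hj _
    exact mul_nonneg (sub_nonneg.2 (singNum_antitone A (Finset.mem_range.1 hj).le)) (sq_nonneg _)

lemma exists_diag {g : ℕ → H} (hg : OZ g) (b : ℕ → ℝ) (hb : Tendsto b atTop (𝓝 0)) :
    ∃ X : H →L[ℂ] H, HasSum (fun n => (b n : ℂ) • rOne (g n)) X := by
  have hs : Summable (fun n => (b n : ℂ) • rOne (g n)) := by
    rw [summable_iff_vanishing_norm]
    intro ε hε
    obtain ⟨N, hN⟩ := (Metric.tendsto_atTop.1 hb) (ε / 2) (by positivity)
    refine ⟨Finset.range N, fun F hF => ?_⟩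
    refine (hg.diag_bound F b (ε / 2) (by positivity) fun n hn => ?_).trans_lt (by linarith)
    have hn' : N ≤ n := by
      by_contra hlt
      exact (Finset.disjoint_left.1 hF hn) (Finset.mem_range.2 (not_le.1 hlt))
    have := hN n hn'
    rw [Real.dist_eq, sub_zero] at this
    exact this.le
  exact ⟨_, hs.hasSum⟩

lemma finRank_compact (F : Finset ℕ) (g : ℕ → H) (b : ℕ → ℝ) :
    IsCompactOperator (⇑(∑ n ∈ F, (b n : ℂ) • rOne (g n) : H →L[ℂ] H)) := by
  classical
  induction F using Finset.induction_on with
  | empty => simpa using isCompactOperator_zero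
  | insert a F ha ih =>
    rw [Finset.sum_insert ha]
    exact ((rOne_compact (g a)).smul (b a : ℂ)).add ih

lemma diag_compact {g : ℕ → H} {b : ℕ → ℝ} {X : H →L[ℂ] H}
    (h : HasSum (fun n => (b n : ℂ) • rOne (g n)) X) : IsCompactOperator (⇑X) := by
  exact isCompactOperator_of_tendsto (l := atTop) (h : Tendsto _ _ _)
    (Eventually.of_forall fun F => finRank_compact F g b)

lemma diag_singNum {g : ℕ → H} (hg : OZ g) {b : ℕ → ℝ} {X : H →L[ℂ] H}
    (h : HasSum (fun n => (b n : ℂ) • rOne (g n)) X) (F : Finset ℕ) (c : ℝ) (hc : 0 ≤ c)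
    (hb : ∀ n, n ∉ F → |b n| ≤ c) : singNum X F.card ≤ c := by
  classical
  refine (singNum_le X _ F.card (finDim_sum g F b).1 (finDim_sum g F b).2).trans ?_
  have h1 : Tendsto (fun G : Finset ℕ => ∑ n ∈ G, (b n : ℂ) • rOne (g n)
      - ∑ n ∈ F, (b n : ℂ) • rOne (g n)) atTop (𝓝 (X - ∑ n ∈ F, (b n : ℂ) • rOne (g n))) :=
    Tendsto.sub_const (h : Tendsto _ _ _) _
  refine le_of_tendsto h1.norm ?_
  filter_upwards [eventually_ge_atTop F] with G hG
  rw [← Finset.sum_sdiff hG, add_sub_cancel_right]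
  exact hg.diag_bound _ b c hc fun n hn => hb n (Finset.mem_sdiff.1 hn).2

lemma absCLM_eq (x : H →L[ℂ] H) : absCLM x = CFC.abs x := by
  rw [absCLM, CFC.abs, CFC.sqrt_eq_real_sqrt (star x * x) (star_mul_self_nonneg x), cfcₙ_eq_cfc (hf0 := by simp)]

lemma exists_polar (x A : H →L[ℂ] H) (hA : star A = A) (h : A * A = star x * x) :
    ∃ U : H →L[ℂ] H, ‖U‖ ≤ 1 ∧ U * A = x ∧ star U * x = A := by
  have hin : ∀ v w, inner ℂ (x v) (x w) = inner ℂ (A v) (A w) := by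
    intro v w
    have h1 : inner ℂ (x v) (x w) = inner ℂ v ((star x * x) w) := by
      rw [ContinuousLinearMap.star_eq_adjoint, ContinuousLinearMap.mul_apply,
        ContinuousLinearMap.adjoint_inner_right]
    have h2 : inner ℂ (A v) (A w) = inner ℂ v ((star A * A) w) := by
      rw [ContinuousLinearMap.star_eq_adjoint, ContinuousLinearMap.mul_apply,
        ContinuousLinearMap.adjoint_inner_right]
    rw [h1, h2, hA, h]
  have hno : ∀ v, ‖x v‖ = ‖A v‖ := by
    intro v
    rw [@norm_eq_sqrt_re_inner ℂ, @norm_eq_sqrt_re_inner ℂ, hin]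
  let K : Submodule ℂ H := (LinearMap.range (A : H →ₗ[ℂ] H)).topologicalClosure
  have hmem : ∀ v, A v ∈ K := fun v => Submodule.le_topologicalClosure _ ⟨v, rfl⟩
  have : CompleteSpace K := (Submodule.isClosed_topologicalClosure _).completeSpace_coe
  let e : H →ₗ[ℂ] K := LinearMap.codRestrict K (A : H →ₗ[ℂ] H) hmem
  have hd : DenseRange e := by
    rw [denseRange_iff_closure_range]
    ext ⟨k, hk⟩
    simp only [Set.mem_univ, iff_true]
    rw [closure_subtype]
    have : (Subtype.val '' Set.range e : Set H) = (LinearMap.range (A : H →ₗ[ℂ] H) : Set H) := by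
      ext z
      constructor
      · rintro ⟨_, ⟨v, rfl⟩, rfl⟩; exact ⟨v, rfl⟩
      · rintro ⟨v, rfl⟩; exact ⟨_, ⟨v, rfl⟩, rfl⟩
    rw [this]
    exact hk
  have hb : ∀ v, ‖(x : H →ₗ[ℂ] H) v‖ ≤ 1 * ‖e v‖ := fun v => by
    rw [one_mul]; exact (hno v).le
  let V : K →L[ℂ] H := LinearMap.extendOfNorm (x : H →ₗ[ℂ] H) e
  have hV : ∀ v, V (e v) = x v := fun v => LinearMap.extendOfNorm_eq hd ⟨1, hb⟩ v
  have hVn : ‖V‖ ≤ 1 := LinearMap.opNorm_extendOfNorm_le hd zero_le_one hb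
  let P : H →L[ℂ] K := K.orthogonalProjectionOnto
  have hP : ‖P‖ ≤ 1 := K.orthogonalProjectionOnto_norm_le
  have hPe : ∀ v, P (A v) = e v := fun v => K.orthogonalProjectionOnto_mem_subspace_eq_self (e v)
  refine ⟨V ∘L P, ?_, ?_, ?_⟩
  · refine (ContinuousLinearMap.opNorm_comp_le _ _).trans ?_
    nlinarith [norm_nonneg V, norm_nonneg P]
  · ext v
    change V (P (A v)) = x v
    rw [hPe, hV]
  · ext v
    refine ext_inner_right ℂ fun w => ?_
    rw [ContinuousLinearMap.star_eq_adjoint, ContinuousLinearMap.mul_apply,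
        ContinuousLinearMap.adjoint_inner_left]
    change inner ℂ (x v) (V (P w)) = _
    have h1 : ∀ k : K, inner ℂ (x v) (V k) = inner ℂ (A v) (k : H) := by
      intro k
      refine hd.induction_on (p := fun k : K => inner ℂ (x v) (V k) = inner ℂ (A v) (k : H)) k ?_ ?_
      · exact isClosed_eq (by fun_prop) (by fun_prop)
      · intro w'
        rw [hV, hin]; rfl
    rw [h1]
    have := K.inner_orthogonalProjectionOnto_eq_of_mem_right (⟨A v, hmem v⟩ : K) w
    rw [← inner_conj_symm, ← inner_conj_symm (A v) w]
    congr 1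

lemma abs_polar (x : H →L[ℂ] H) :
    ∃ U : H →L[ℂ] H, ‖U‖ ≤ 1 ∧ U * CFC.abs x = x ∧ star U * x = CFC.abs x :=
  exists_polar x _ (CFC.abs_nonneg x).isSelfAdjoint.star_eq (CFC.abs_mul_abs x)

lemma compact_mul_left {x : H →L[ℂ] H} (hx : IsCompactOperator (⇑x)) (U : H →L[ℂ] H) :
    IsCompactOperator (⇑(U * x)) := hx.clm_comp U

lemma compact_mul_right {x : H →L[ℂ] H} (hx : IsCompactOperator (⇑x)) (U : H →L[ℂ] H) :
    IsCompactOperator (⇑(x * U)) := hx.comp_clm U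

lemma abs_compact {x : H →L[ℂ] H} (hx : IsCompactOperator (⇑x)) :
    IsCompactOperator (⇑(CFC.abs x)) := by
  obtain ⟨U, -, -, h⟩ := abs_polar x
  rw [← h]; exact compact_mul_left hx _

lemma star_compact {x : H →L[ℂ] H} (hx : IsCompactOperator (⇑x)) :
    IsCompactOperator (⇑(star x)) := by
  obtain ⟨U, -, h, -⟩ := abs_polar x
  have : star x = CFC.abs x * star U := by
    conv_lhs => rw [← h]
    rw [star_mul, (CFC.abs_nonneg x).isSelfAdjoint.star_eq]
  rw [this]; exact compact_mul_right (abs_compact hx) _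

lemma abs_isPositive (x : H →L[ℂ] H) : (CFC.abs x).IsPositive :=
  (ContinuousLinearMap.nonneg_iff_isPositive _).1 (CFC.abs_nonneg x)

lemma schattenNorm_mul_le (p : ℝ≥0∞) (U y : H →L[ℂ] H) (hU : ‖U‖ ≤ 1) :
    schattenNorm p (U * y) ≤ schattenNorm p y := by
  refine eLpNorm_mono fun n => ?_
  rw [Real.norm_of_nonneg (singNum_nonneg _ _), Real.norm_of_nonneg (singNum_nonneg _ _)]
  exact singNum_comp_le U y hU n

lemma Kschatten_mul_le (t : ℝ) (p₀ p₁ : ℝ≥0∞) (U y : H →L[ℂ] H) (hU : ‖U‖ ≤ 1) :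
    Kschatten t p₀ p₁ (U * y) ≤ Kschatten t p₀ p₁ y := by
  refine le_sInf ?_
  rintro _ ⟨y₀, y₁, rfl, h0, h1, rfl⟩
  have h : Kschatten t p₀ p₁ (U * (y₀ + y₁)) ≤
      schattenNorm p₀ (U * y₀) + ENNReal.ofReal t * schattenNorm p₁ (U * y₁) :=
    sInf_le ⟨U * y₀, U * y₁, mul_add _ _ _, compact_mul_left h0 U, compact_mul_left h1 U, rfl⟩
  refine h.trans ?_
  gcongr <;> exact schattenNorm_mul_le _ _ _ hU

lemma Kschatten_abs (t : ℝ) (p₀ p₁ : ℝ≥0∞) (x : H →L[ℂ] H) :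
    Kschatten t p₀ p₁ x = Kschatten t p₀ p₁ (CFC.abs x) := by
  obtain ⟨U, hU, h1, h2⟩ := abs_polar x
  apply le_antisymm
  · conv_lhs => rw [← h1]
    exact Kschatten_mul_le _ _ _ _ _ hU
  · conv_lhs => rw [← h2]
    exact Kschatten_mul_le _ _ _ _ _ (by rwa [norm_star])

/-- positive compact majorant of the real part. -/
lemma exists_majorant (x : H →L[ℂ] H) (hx : IsCompactOperator (⇑x)) :
    ∃ B : H →L[ℂ] H, B.IsPositive ∧ IsCompactOperator (⇑B) ∧
      (∀ v, (inner ℂ (x v) v).re ≤ (inner ℂ (B v) v).re) ∧ ∀ n, singNum B n ≤ singNum x n := by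
  let a : H →L[ℂ] H := (1 / 2 : ℂ) • (x + star x)
  have ha : IsSelfAdjoint a := by
    rw [IsSelfAdjoint, star_smul, star_add, star_star, add_comm (star x)]
    simp [a]
  have hac : IsCompactOperator (⇑a) := (hx.add (star_compact hx)).smul (1 / 2 : ℂ)
  have hre : ∀ v, (inner ℂ (a v) v).re = (inner ℂ (x v) v).re := by
    intro v
    have h1 : inner ℂ ((star x) v) v = (starRingEnd ℂ) (inner ℂ (x v) v) := by
      rw [ContinuousLinearMap.star_eq_adjoint, ContinuousLinearMap.adjoint_inner_left, inner_conj_symm]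
    simp only [a, ContinuousLinearMap.smul_apply, ContinuousLinearMap.add_apply]
    rw [inner_smul_left, inner_add_left, h1, Complex.add_conj]
    simp [Complex.mul_re]
  have hBp : (a⁺).IsPositive := (ContinuousLinearMap.nonneg_iff_isPositive _).1 (CFC.posPart_nonneg a)
  have hNp : (a⁻).IsPositive := (ContinuousLinearMap.nonneg_iff_isPositive _).1 (CFC.negPart_nonneg a)
  have hBN : a⁺ - a⁻ = a := CFC.posPart_sub_negPart a ha
  have hBc : IsCompactOperator (⇑(a⁺)) := by
    have h1 : a⁺ = (1 / 2 : ℂ) • (CFC.abs a + a) := by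
      rw [CFC.abs_add_self a ha, ← Nat.cast_smul_eq_nsmul ℂ, smul_smul]
      norm_num
    rw [h1]
    exact ((abs_compact hac).add hac).smul (1 / 2 : ℂ)
  have hform : ∀ v, (inner ℂ (a v) v).re = (inner ℂ (a⁺ v) v).re - (inner ℂ (a⁻ v) v).re := by
    intro v
    conv_lhs => rw [← hBN]
    rw [ContinuousLinearMap.sub_apply, inner_sub_left, Complex.sub_re]
  refine ⟨a⁺, hBp, hBc, fun v => ?_, fun n => ?_⟩
  · rw [← hre, hform]
    have := hNp.re_inner_nonneg_left v
    simp only [RCLike.re_to_complex] at this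
    linarith
  · obtain ⟨g, hg⟩ := exists_spec a⁺ hBp hBc
    refine hg.le_of_form x n fun c v hv => ?_
    rw [← hre, hform]
    have hz : ∀ k, a⁻ (g k) = 0 := by
      intro k
      by_cases hk : singNum a⁺ k = 0
      · rw [hg.zero k hk, map_zero]
      have h1 : (a⁻ * a⁺) (g k) = 0 := by rw [CFC.negPart_mul_posPart]; rfl
      rw [ContinuousLinearMap.mul_apply, hg.eig, map_smul] at h1
      exact (smul_eq_zero.1 h1).resolve_left (by exact_mod_cast hk)
    have : a⁻ v = 0 := by
      rw [hv, map_sum]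
      exact Finset.sum_eq_zero fun k _ => by rw [map_smul, hz, smul_zero]
    rw [this]; simp

/-! ### sequence lemmas -/

lemma exists_injective_pick (P : ℕ → ℕ → Prop) (h : ∀ F : Finset ℕ, ∃ n, n ∉ F ∧ P F.card n) :
    ∃ σ : ℕ → ℕ, Function.Injective σ ∧ ∀ n, P n (σ n) := by
  classical
  choose pick hp1 hp2 using h
  let st : ℕ → Finset ℕ := fun n => Nat.rec ∅ (fun _ F => insert (pick F) F) n
  have hst : ∀ n, st (n + 1) = insert (pick (st n)) (st n) := fun n => rfl
  have hcard : ∀ n, (st n).card = n := by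
    intro n
    induction n with
    | zero => rfl
    | succ n ih => rw [hst, Finset.card_insert_of_notMem (hp1 _), ih]
  have hmono : Monotone st := monotone_nat_of_le_succ fun n => by
    rw [hst]; exact Finset.subset_insert _ _
  have hlt : ∀ m n, m < n → pick (st m) ≠ pick (st n) := by
    intro m n hmn he
    apply hp1 (st n)
    rw [← he]
    exact hmono (Nat.succ_le_of_lt hmn) (by rw [hst]; exact Finset.mem_insert_self _ _)
  refine ⟨fun n => pick (st n), ?_, fun n => ?_⟩
  · intro m n he
    by_contra hne
    rcases lt_or_gt_of_ne hne with h | h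
    · exact hlt _ _ h he
    · exact hlt _ _ h he.symm
  · have := hp2 (st n)
    rwa [hcard] at this

lemma eLpNorm_comp_inj_le (b : ℕ → ℝ) (p : ℝ≥0∞) (σ : ℕ → ℕ) (hσ : Function.Injective σ) :
    eLpNorm (b ∘ σ) p Measure.count ≤ eLpNorm b p Measure.count := by
  rw [← eLpNorm_map_measure (StronglyMeasurable.of_discrete).aestronglyMeasurable
    (Measurable.of_discrete).aemeasurable]
  refine eLpNorm_mono_measure _ ?_
  refine Measure.le_iff.2 fun s hs => ?_
  rw [Measure.map_apply Measurable.of_discrete hs, Measure.count_apply (measurableSet_preimage Measurable.of_discrete hs),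
    Measure.count_apply hs]
  refine ENat.toENNReal_mono ?_
  rw [← hσ.encard_image]
  exact Set.encard_le_encard (Set.image_preimage_subset σ s)

lemma eLpNorm_le_of_rearr (p : ℝ≥0∞) (a b : ℕ → ℝ) (ha : ∀ n, 0 ≤ a n)
    (h : ∀ (F : Finset ℕ) (c : ℝ), 0 ≤ c → (∀ n, n ∉ F → |b n| ≤ c) → a F.card ≤ c) :
    eLpNorm a p Measure.count ≤ eLpNorm b p Measure.count := by
  refine ENNReal.le_of_forall_lt_one_mul_le fun θ hθ => ?_
  lift θ to ℝ≥0 using (hθ.trans ENNReal.one_lt_top).ne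
  have hθ1 : (θ : ℝ) < 1 := by exact_mod_cast hθ
  obtain ⟨σ, hσ, hσ2⟩ := exists_injective_pick (fun k n => (θ : ℝ) * a k ≤ |b n|) (by
    intro F
    by_contra hcon
    push Not at hcon
    have h1 := h F ((θ : ℝ) * a F.card) (mul_nonneg θ.coe_nonneg (ha _)) fun n hn => (hcon n hn).le
    have h2 : a F.card = 0 := by nlinarith [ha F.card]
    obtain ⟨n, hn⟩ := Infinite.exists_notMem_finset F
    have := hcon n hn
    rw [h2, mul_zero] at this
    exact absurd this (not_lt.2 (abs_nonneg _)))
  calc (θ : ℝ≥0∞) * eLpNorm a p Measure.count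
      = eLpNorm ((θ : ℝ) • a) p Measure.count := by
        rw [eLpNorm_const_smul]
        congr 1
        rw [Real.enorm_eq_ofReal θ.coe_nonneg, ENNReal.ofReal_coe_nnreal]
    _ ≤ eLpNorm (b ∘ σ) p Measure.count := by
        refine eLpNorm_mono fun n => ?_
        simp only [Pi.smul_apply, smul_eq_mul, Function.comp, Real.norm_eq_abs]
        rw [abs_of_nonneg (mul_nonneg θ.coe_nonneg (ha n))]
        exact hσ2 n
    _ ≤ _ := eLpNorm_comp_inj_le b p σ hσ

lemma Kseq_le (t : ℝ) (p₀ p₁ : ℝ≥0∞) (b₀ b₁ : ℕ → ℝ) :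
    Kseq t p₀ p₁ (b₀ + b₁) ≤
      eLpNorm b₀ p₀ Measure.count + ENNReal.ofReal t * eLpNorm b₁ p₁ Measure.count :=
  sInf_le ⟨b₀, b₁, rfl, rfl⟩

lemma clamp_aux (a b₀ b₁ : ℝ) (ha : 0 ≤ a) (hab : a ≤ b₀ + b₁) :
    0 ≤ max 0 (min b₀ a) ∧ max 0 (min b₀ a) ≤ a ∧ |max 0 (min b₀ a)| ≤ |b₀| ∧
    0 ≤ a - max 0 (min b₀ a) ∧ |a - max 0 (min b₀ a)| ≤ |b₁| := by
  have h1 : 0 ≤ max 0 (min b₀ a) := le_max_left _ _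
  have h2 : max 0 (min b₀ a) ≤ a := max_le ha (min_le_right _ _)
  refine ⟨h1, h2, ?_, by linarith, ?_⟩
  · rw [abs_of_nonneg h1]
    exact max_le (abs_nonneg _) ((min_le_left _ _).trans (le_abs_self _))
  · rw [abs_of_nonneg (by linarith)]
    rcases le_total b₀ a with h | h
    · rw [min_eq_left h]
      have := le_max_right 0 b₀
      have := le_abs_self b₁
      linarith
    · rw [min_eq_right h, max_eq_right ha, sub_self]; exact abs_nonneg _

lemma Kseq_mono (t : ℝ) (p₀ p₁ : ℝ≥0∞) (a a' : ℕ → ℝ) (ha : ∀ n, 0 ≤ a n) (haa : ∀ n, a n ≤ a' n) :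
    Kseq t p₀ p₁ a ≤ Kseq t p₀ p₁ a' := by
  refine le_sInf ?_
  rintro _ ⟨b₀, b₁, rfl, rfl⟩
  have h := fun n => clamp_aux (a n) (b₀ n) (b₁ n) (ha n) (haa n)
  have he : a = (fun n => max 0 (min (b₀ n) (a n))) + fun n => a n - max 0 (min (b₀ n) (a n)) := by
    ext n; simp
  have h1 := Kseq_le t p₀ p₁ (fun n => max 0 (min (b₀ n) (a n))) (fun n => a n - max 0 (min (b₀ n) (a n)))
  rw [← he] at h1
  refine h1.trans ?_
  gcongr
  · exact eLpNorm_mono fun n => (h n).2.2.1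
  · exact eLpNorm_mono fun n => (h n).2.2.2.2

lemma Kschatten_le_Kseq (t : ℝ) (p₀ p₁ : ℝ≥0∞) (A : H →L[ℂ] H) (hp : A.IsPositive)
    (hc : IsCompactOperator (⇑A)) :
    Kschatten t p₀ p₁ A ≤ Kseq t p₀ p₁ (singNum A) := by
  obtain ⟨g, hg⟩ := exists_spec A hp hc
  refine le_sInf ?_
  rintro _ ⟨b₀, b₁, he, rfl⟩
  have h := fun n => clamp_aux (singNum A n) (b₀ n) (b₁ n) (singNum_nonneg A n) (by rw [he]; rfl)
  set d₀ : ℕ → ℝ := fun n => max 0 (min (b₀ n) (singNum A n)) with hd₀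
  have ht0 : Tendsto d₀ atTop (𝓝 0) :=
    squeeze_zero (fun n => (h n).1) (fun n => (h n).2.1) hg.tend
  obtain ⟨X, hX⟩ := exists_diag hg.oz d₀ ht0
  have hX1 : HasSum (fun n => ((singNum A n - d₀ n : ℝ) : ℂ) • rOne (g n)) (A - X) := by
    have := hg.hasSum.sub hX
    simpa only [Complex.ofReal_sub, sub_smul] using this
  have hK : Kschatten t p₀ p₁ A ≤ schattenNorm p₀ X + ENNReal.ofReal t * schattenNorm p₁ (A - X) :=
    sInf_le ⟨X, A - X, by abel, diag_compact hX, diag_compact hX1, rfl⟩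
  refine hK.trans ?_
  gcongr
  · refine (eLpNorm_le_of_rearr p₀ _ d₀ (singNum_nonneg X)
      fun F c hc hb => diag_singNum hg.oz hX F c hc hb).trans ?_
    exact eLpNorm_mono fun n => (h n).2.2.1
  · refine (eLpNorm_le_of_rearr p₁ _ (fun n => singNum A n - d₀ n) (singNum_nonneg (A - X))
      fun F c hc hb => diag_singNum hg.oz hX1 F c hc hb).trans ?_
    exact eLpNorm_mono fun n => (h n).2.2.2.2

lemma exists_enum (d : ℕ → ℝ) (k : ℕ) : ∀ I : Finset ℕ, I.card = k → ∃ τ : ℕ → ℕ,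
    I = (Finset.range k).image τ ∧ Set.InjOn τ (Finset.range k) ∧
    ∀ i j, i ≤ j → j < k → d (τ j) ≤ d (τ i) := by
  classical
  induction k with
  | zero => intro I hI; exact ⟨id, by simpa using hI, by simp, by simp⟩
  | succ k ih =>
    intro I hI
    have hne : I.Nonempty := Finset.card_pos.1 (by omega)
    obtain ⟨m, hm, hmin⟩ := I.exists_min_image d hne
    obtain ⟨τ, h1, h2, h3⟩ := ih (I.erase m) (by rw [Finset.card_erase_of_mem hm, hI]; rfl)
    have hval : ∀ i, i < k → (fun i => if i < k then τ i else m) i = τ i := fun i hi => by simp [hi]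
    have hmem : ∀ i, i < k → τ i ∈ I.erase m := fun i hi => by
      rw [h1]; exact Finset.mem_image_of_mem _ (Finset.mem_range.2 hi)
    refine ⟨fun i => if i < k then τ i else m, ?_, ?_, ?_⟩
    · rw [Finset.range_add_one, Finset.image_insert, ← Finset.insert_erase hm]
      congr 1
      · simp
      · rw [h1]
        exact Finset.image_congr fun i hi => (hval i (by simpa using hi)).symm
    · intro i hi j hj hij
      simp only [Finset.coe_range, Set.mem_Iio] at hi hj
      by_cases hik : i < k <;> by_cases hjk : j < k
      · simp only [hik, hjk, if_true] at hij
        exact h2 (by simpa using hik) (by simpa using hjk) hij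
      · simp only [hik, hjk, if_true, if_false] at hij
        exact absurd hij (Finset.ne_of_mem_erase (hmem i hik))
      · simp only [hik, hjk, if_true, if_false] at hij
        exact absurd hij.symm (Finset.ne_of_mem_erase (hmem j hjk))
      · omega
    · intro i j hij hj
      by_cases hjk : j < k
      · have hik : i < k := by omega
        simp only [hik, hjk, if_true]
        exact h3 i j hij hjk
      · by_cases hik : i < k
        · simp only [hik, hjk, if_true, if_false]
          exact hmin _ (Finset.mem_of_mem_erase (hmem i hik))
        · simp [hik, hjk]

lemma abel_nonneg (k : ℕ) (w x : ℕ → ℝ) (hw : ∀ i, i < k → 0 ≤ w i)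
    (hwa : ∀ i, i + 1 < k → w (i + 1) ≤ w i)
    (hx : ∀ m ≤ k, 0 ≤ ∑ i ∈ Finset.range m, x i) : 0 ≤ ∑ i ∈ Finset.range k, w i * x i := by
  rcases k with _ | k
  · simp
  have key : ∀ m, m ≤ k → w m * ∑ i ∈ Finset.range (m + 1), x i ≤ ∑ i ∈ Finset.range (m + 1), w i * x i := by
    intro m
    induction m with
    | zero => intro _; simp
    | succ m ih =>
      intro hm
      have h1 := ih (by omega)
      have h2 := hwa m (by omega)
      have h3 := hx (m + 1) (by omega)
      rw [Finset.sum_range_succ _ (m + 1), Finset.sum_range_succ (fun i => w i * x i) (m + 1)]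
      nlinarith
  exact (mul_nonneg (hw k (by omega)) (hx (k + 1) le_rfl)).trans (key k le_rfl)

lemma tangent_rpow (c d p : ℝ) (hc : 0 ≤ c) (hd : 0 ≤ d) (hp : 1 ≤ p) :
    p * d ^ (p - 1) * (c - d) ≤ c ^ p - d ^ p := by
  rcases hd.eq_or_lt with h | h
  · subst h
    rcases hp.eq_or_lt with h1 | h1
    · subst h1; simp
    · rw [Real.zero_rpow (by linarith), Real.zero_rpow (by linarith)]
      simp; positivity
  have h1 := one_add_mul_self_le_rpow_one_add (s := c / d - 1) (by
    have : 0 ≤ c / d := by positivity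
    linarith) hp
  rw [add_sub_cancel, Real.div_rpow hc hd] at h1
  have hdp : 0 < d ^ p := by positivity
  rw [le_div_iff₀ hdp] at h1
  have h2 : d ^ p = d ^ (p - 1) * d := by
    rw [← Real.rpow_add_one h.ne']; ring_nf
  have h3 : (1 + p * (c / d - 1)) * d ^ p = d ^ p + p * d ^ (p - 1) * (c - d) := by
    rw [h2]; field_simp
  linarith

lemma weak_major_finite (d c : ℕ → ℝ) (hd : ∀ n, 0 ≤ d n) (hc : ∀ n, 0 ≤ c n)
    (h : ∀ I : Finset ℕ, ∑ i ∈ I, d i ≤ ∑ j ∈ Finset.range I.card, c j) (p : ℝ) (hp : 1 ≤ p)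
    (I : Finset ℕ) : ∑ i ∈ I, d i ^ p ≤ ∑ j ∈ Finset.range I.card, c j ^ p := by
  classical
  obtain ⟨τ, h1, h2, h3⟩ := exists_enum d I.card I rfl
  have h4 : ∑ i ∈ I, d i ^ p = ∑ j ∈ Finset.range I.card, d (τ j) ^ p := by
    conv_lhs => rw [h1]
    rw [Finset.sum_image h2]
  rw [h4, ← sub_nonneg, ← Finset.sum_sub_distrib]
  have h5 := abel_nonneg I.card (fun j => p * d (τ j) ^ (p - 1)) (fun j => c j - d (τ j))
    (fun i _ => mul_nonneg (by linarith) (Real.rpow_nonneg (hd _) _))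
    (fun i hi => mul_le_mul_of_nonneg_left
      (Real.rpow_le_rpow (hd _) (h3 i (i + 1) (by omega) hi) (by linarith)) (by linarith))
    (by
      intro m hm
      rw [Finset.sum_sub_distrib, sub_nonneg]
      have hinj : Set.InjOn τ (Finset.range m) := h2.mono (by
        simpa using Set.Iio_subset_Iio hm)
      have := h ((Finset.range m).image τ)
      rw [Finset.sum_image hinj, Finset.card_image_of_injOn hinj, Finset.card_range] at this
      exact this)
  exact h5.trans (Finset.sum_le_sum fun j _ => tangent_rpow _ _ _ (hc j) (hd _) hp)

lemma eLpNorm_count (b : ℕ → ℝ) (p : ℝ≥0∞) (hp0 : p ≠ 0) (hp : p ≠ ∞) :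
    eLpNorm b p Measure.count = (∑' n, ‖b n‖ₑ ^ p.toReal) ^ (1 / p.toReal) := by
  rw [eLpNorm_eq_lintegral_rpow_enorm_toReal hp0 hp, lintegral_count]

lemma enorm_le_eLpNorm_top (b : ℕ → ℝ) (n : ℕ) : ‖b n‖ₑ ≤ eLpNorm b ∞ Measure.count := by
  rw [eLpNorm_exponent_top, eLpNormEssSup]
  have h := enorm_ae_le_eLpNormEssSup b (Measure.count : Measure ℕ)
  rw [ae_iff, Measure.count_eq_zero_iff] at h
  by_contra hcon
  exact (Set.eq_empty_iff_forall_notMem.1 h) n hcon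

lemma eLpNorm_le_of_weak_major (d c : ℕ → ℝ) (hd : ∀ n, 0 ≤ d n) (hc : ∀ n, 0 ≤ c n)
    (h : ∀ I : Finset ℕ, ∑ i ∈ I, d i ≤ ∑ j ∈ Finset.range I.card, c j) (p : ℝ≥0∞) (hp : 1 ≤ p) :
    eLpNorm d p Measure.count ≤ eLpNorm c p Measure.count := by
  by_cases hpt : p = ∞
  · subst hpt
    rw [eLpNorm_exponent_top]
    refine eLpNormEssSup_le_of_ae_enorm_bound (Eventually.of_forall fun n => ?_)
    have h1 := h {n}
    simp at h1
    refine le_trans ?_ (enorm_le_eLpNorm_top c 0)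
    rw [Real.enorm_eq_ofReal (hd n), Real.enorm_eq_ofReal (hc 0)]
    exact ENNReal.ofReal_le_ofReal h1
  have hp0 : p ≠ 0 := (lt_of_lt_of_le zero_lt_one hp).ne'
  have hp1 : 1 ≤ p.toReal := by
    have := (ENNReal.toReal_le_toReal ENNReal.one_ne_top hpt).2 hp
    simpa using this
  rw [eLpNorm_count _ _ hp0 hpt, eLpNorm_count _ _ hp0 hpt]
  refine ENNReal.rpow_le_rpow ?_ (by positivity)
  rw [ENNReal.tsum_eq_iSup_sum]
  refine iSup_le fun I => ?_
  refine le_trans ?_ (ENNReal.sum_le_tsum (Finset.range I.card))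
  have hconv : ∀ (b : ℕ → ℝ), (∀ n, 0 ≤ b n) → ∀ F : Finset ℕ,
      ∑ n ∈ F, ‖b n‖ₑ ^ p.toReal = ENNReal.ofReal (∑ n ∈ F, b n ^ p.toReal) := by
    intro b hb F
    rw [ENNReal.ofReal_sum_of_nonneg fun n _ => Real.rpow_nonneg (hb n) _]
    refine Finset.sum_congr rfl fun n _ => ?_
    rw [Real.enorm_eq_ofReal (hb n), ENNReal.ofReal_rpow_of_nonneg (hb n) (by linarith)]
  rw [hconv d hd, hconv c hc]
  exact ENNReal.ofReal_le_ofReal (weak_major_finite d c hd hc h _ hp1 I)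

/-! ### the case `p₁ ≥ 1` -/

lemma finsum_form (g : ℕ → H) (F : Finset ℕ) (b : ℕ → ℝ) (v : H) :
    (inner ℂ ((∑ n ∈ F, (b n : ℂ) • rOne (g n) : H →L[ℂ] H) v) v).re
      = ∑ n ∈ F, b n * ‖inner ℂ (g n) v‖ ^ 2 := by
  rw [ContinuousLinearMap.sum_apply, sum_inner, Complex.re_sum]
  exact Finset.sum_congr rfl fun n _ => inner_diag g b n v

lemma finsum_isPositive (g : ℕ → H) (F : Finset ℕ) (b : ℕ → ℝ) (hb : ∀ n ∈ F, 0 ≤ b n) :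
    (∑ n ∈ F, (b n : ℂ) • rOne (g n) : H →L[ℂ] H).IsPositive := by
  classical
  induction F using Finset.induction_on with
  | empty => simpa using ContinuousLinearMap.isPositive_zero
  | insert a F ha ih =>
    rw [Finset.sum_insert ha]
    refine ContinuousLinearMap.IsPositive.add ?_ (ih fun n hn => hb n (Finset.mem_insert_of_mem hn))
    refine ContinuousLinearMap.IsPositive.smul_of_nonneg (InnerProductSpace.isPositive_rankOne_self _) ?_
    exact_mod_cast hb a (Finset.mem_insert_self _ _)

lemma Spec.form_eig {A : H →L[ℂ] H} {g : ℕ → H} (h : Spec A g) (n : ℕ) :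
    (inner ℂ (A (g n)) (g n)).re = singNum A n := by
  by_cases hn : singNum A n = 0
  · rw [h.eig, hn]; simp
  · rw [h.eig, inner_smul_left, inner_self_eq_norm_sq_to_K, h.unit n hn]; simp

lemma Spec.sum_form_le {B : H →L[ℂ] H} {e : ℕ → H} (h : Spec B e) {g : ℕ → H} (hg : OZ g) (N : ℕ) :
    ∑ i ∈ Finset.range N, (inner ℂ (B (g i)) (g i)).re ≤ ∑ i ∈ Finset.range N, singNum B i := by
  calc ∑ i ∈ Finset.range N, (inner ℂ (B (g i)) (g i)).re
      ≤ ∑ i ∈ Finset.range N, (∑ j ∈ Finset.range N,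
          (singNum B j - singNum B N) * ‖inner ℂ (e j) (g i)‖ ^ 2 + singNum B N * ‖g i‖ ^ 2) :=
        Finset.sum_le_sum fun i _ => h.trunc N (g i)
    _ = ∑ j ∈ Finset.range N, (singNum B j - singNum B N) * ∑ i ∈ Finset.range N, ‖inner ℂ (g i) (e j)‖ ^ 2
          + singNum B N * ∑ i ∈ Finset.range N, ‖g i‖ ^ 2 := by
        rw [Finset.sum_add_distrib, Finset.sum_comm, Finset.mul_sum]
        congr 1
        refine Finset.sum_congr rfl fun j _ => ?_
        rw [Finset.mul_sum]
        refine Finset.sum_congr rfl fun i _ => ?_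
        rw [norm_inner_symm]
    _ ≤ ∑ j ∈ Finset.range N, (singNum B j - singNum B N) * 1 + singNum B N * ∑ i ∈ Finset.range N, 1 := by
        refine add_le_add (Finset.sum_le_sum fun j hj => mul_le_mul_of_nonneg_left ?_ ?_)
          (mul_le_mul_of_nonneg_left (Finset.sum_le_sum fun i _ => ?_) (singNum_nonneg _ _))
        · exact (hg.bessel _ _).trans (pow_le_one₀ (norm_nonneg _) (h.oz.norm_le j))
        · exact sub_nonneg.2 (singNum_antitone B (Finset.mem_range.1 hj).le)
        · exact pow_le_one₀ (norm_nonneg _) (hg.norm_le i)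
    _ = _ := by
        simp [Finset.sum_sub_distrib, mul_comm]

lemma lidskii {A B C : H →L[ℂ] H} (hA : A.IsPositive) (hAc : IsCompactOperator (⇑A))
    (hB : B.IsPositive) (hBc : IsCompactOperator (⇑B))
    (hC : C.IsPositive) (hCc : IsCompactOperator (⇑C))
    (h : ∀ v, (inner ℂ (A v) v).re ≤ (inner ℂ (B v) v).re + (inner ℂ (C v) v).re) (I : Finset ℕ) :
    ∑ i ∈ I, max (singNum A i - singNum B i) 0 ≤ ∑ j ∈ Finset.range I.card, singNum C j := by
  obtain ⟨f, hf⟩ := exists_spec C hC hCc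
  obtain ⟨e, he⟩ := exists_spec B hB hBc
  obtain ⟨a, ha⟩ := exists_spec A hA hAc
  set k := I.card with hk
  set w : ℕ → ℝ := fun j => singNum C j - singNum C k with hw
  have hw0 : ∀ j ∈ Finset.range k, 0 ≤ w j := fun j hj =>
    sub_nonneg.2 (singNum_antitone C (Finset.mem_range.1 hj).le)
  set C' : H →L[ℂ] H := ∑ j ∈ Finset.range k, (w j : ℂ) • rOne (f j) with hC'
  have hTp : (B + C').IsPositive := hB.add (finsum_isPositive f _ w hw0)
  have hTc : IsCompactOperator (⇑(B + C')) := hBc.add (finRank_compact _ f w)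
  obtain ⟨g, hg⟩ := exists_spec _ hTp hTc
  have hTf : ∀ v, (inner ℂ ((B + C') v) v).re
      = (inner ℂ (B v) v).re + ∑ j ∈ Finset.range k, w j * ‖inner ℂ (f j) v‖ ^ 2 := by
    intro v
    rw [ContinuousLinearMap.add_apply, inner_add_left, Complex.add_re, finsum_form]
  have h1 : ∀ i, singNum A i ≤ singNum (B + C') i + singNum C k := by
    intro i
    refine le_trans ?_ (singNum_add_smul_one (B + C') (singNum C k) (singNum_nonneg _ _) i)
    refine ha.le_of_form _ i fun _ v _ => (h v).trans ?_
    have h3 : (inner ℂ ((B + C' + (singNum C k : ℂ) • (1 : H →L[ℂ] H)) v) v).re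
        = (inner ℂ ((B + C') v) v).re + singNum C k * ‖v‖ ^ 2 := by
      rw [ContinuousLinearMap.add_apply, inner_add_left, Complex.add_re,
        ContinuousLinearMap.smul_apply, ContinuousLinearMap.one_apply, inner_smul_left,
        inner_self_eq_norm_sq_to_K]
      congr 1
      rw [Complex.conj_ofReal, Complex.re_ofReal_mul]
      congr 1
      exact (congrArg Complex.re (Complex.ofReal_pow ‖v‖ 2).symm).trans (Complex.ofReal_re _)
    rw [h3, hTf, add_assoc]
    exact add_le_add le_rfl (hf.trunc k v)
  have h2 : ∀ i, singNum B i ≤ singNum (B + C') i := by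
    intro i
    refine he.le_of_form _ i fun _ v _ => ?_
    rw [hTf]
    have : 0 ≤ ∑ j ∈ Finset.range k, w j * ‖inner ℂ (f j) v‖ ^ 2 :=
      Finset.sum_nonneg fun j hj => mul_nonneg (hw0 j hj) (sq_nonneg _)
    linarith
  obtain ⟨N, hN⟩ : ∃ N, I ⊆ Finset.range N := Finset.exists_nat_subset_range I
  have h3 : ∑ i ∈ Finset.range N, singNum (B + C') i
      ≤ ∑ i ∈ Finset.range N, singNum B i + ∑ j ∈ Finset.range k, w j := by
    calc ∑ i ∈ Finset.range N, singNum (B + C') i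
        = ∑ i ∈ Finset.range N, ((inner ℂ (B (g i)) (g i)).re
            + ∑ j ∈ Finset.range k, w j * ‖inner ℂ (f j) (g i)‖ ^ 2) :=
          Finset.sum_congr rfl fun i _ => by rw [← hg.form_eig i, hTf]
      _ = ∑ i ∈ Finset.range N, (inner ℂ (B (g i)) (g i)).re
          + ∑ j ∈ Finset.range k, w j * ∑ i ∈ Finset.range N, ‖inner ℂ (g i) (f j)‖ ^ 2 := by
          rw [Finset.sum_add_distrib, Finset.sum_comm (s := Finset.range N)]
          congr 1
          refine Finset.sum_congr rfl fun j _ => ?_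
          rw [Finset.mul_sum]
          refine Finset.sum_congr rfl fun i _ => ?_
          rw [norm_inner_symm]
      _ ≤ _ := by
          refine add_le_add (he.sum_form_le hg.oz N) (Finset.sum_le_sum fun j hj => ?_)
          refine mul_le_of_le_one_right (hw0 j hj) ?_
          exact (hg.oz.bessel _ _).trans (pow_le_one₀ (norm_nonneg _) (hf.oz.norm_le j))
  have h4 : ∑ j ∈ Finset.range k, w j = ∑ j ∈ Finset.range k, singNum C j - k * singNum C k := by
    simp [hw, Finset.sum_sub_distrib]
  calc ∑ i ∈ I, max (singNum A i - singNum B i) 0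
      ≤ ∑ i ∈ I, ((singNum (B + C') i - singNum B i) + singNum C k) := by
        refine Finset.sum_le_sum fun i _ => max_le ?_ ?_
        · linarith [h1 i]
        · linarith [h2 i, singNum_nonneg C k]
    _ = ∑ i ∈ I, (singNum (B + C') i - singNum B i) + k * singNum C k := by
        rw [Finset.sum_add_distrib, Finset.sum_const, nsmul_eq_mul]
    _ ≤ ∑ i ∈ Finset.range N, (singNum (B + C') i - singNum B i) + k * singNum C k := by
        refine add_le_add (Finset.sum_le_sum_of_subset_of_nonneg hN fun i _ _ => ?_) le_rfl
        linarith [h2 i]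
    _ ≤ _ := by
        rw [Finset.sum_sub_distrib]; linarith

lemma Kseq_le_caseA (t : ℝ) (p₀ p₁ : ℝ≥0∞) (hp : 1 ≤ p₁)
    {A B C : H →L[ℂ] H} (hA : A.IsPositive) (hAc : IsCompactOperator (⇑A))
    (hB : B.IsPositive) (hBc : IsCompactOperator (⇑B))
    (hC : C.IsPositive) (hCc : IsCompactOperator (⇑C))
    (h : ∀ v, (inner ℂ (A v) v).re ≤ (inner ℂ (B v) v).re + (inner ℂ (C v) v).re) :
    Kseq t p₀ p₁ (singNum A) ≤ schattenNorm p₀ B + ENNReal.ofReal t * schattenNorm p₁ C := by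
  have he : singNum A = (fun n => min (singNum A n) (singNum B n))
      + fun n => max (singNum A n - singNum B n) 0 := by
    ext n
    simp only [Pi.add_apply]
    rcases le_total (singNum A n) (singNum B n) with h | h
    · rw [min_eq_left h, max_eq_right (by linarith)]; ring
    · rw [min_eq_right h, max_eq_left (by linarith)]; ring
  have h1 := Kseq_le t p₀ p₁ (fun n => min (singNum A n) (singNum B n))
    (fun n => max (singNum A n - singNum B n) 0)
  rw [← he] at h1
  refine h1.trans (add_le_add ?_ (mul_le_mul_right ?_ _))
  · refine eLpNorm_mono fun n => ?_
    rw [Real.norm_of_nonneg (le_min (singNum_nonneg _ _) (singNum_nonneg _ _)),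
      Real.norm_of_nonneg (singNum_nonneg _ _)]
    exact min_le_right _ _
  · exact eLpNorm_le_of_weak_major _ _ (fun n => le_max_right _ _) (singNum_nonneg C)
      (lidskii hA hAc hB hBc hC hCc h) p₁ hp

/-! ### the case `p₁ < 1`: sequences -/

lemma merge_exists (v w : ℕ → ℝ≥0∞) (hv : Monotone v) (hw : Monotone w) :
    ∃ (π : ℕ → ℕ ⊕ ℕ) (F : ℕ → Finset (ℕ ⊕ ℕ)) (θ : ℕ → ℝ≥0∞), F 0 = ∅ ∧
      (∀ n, F (n + 1) = insert (π n) (F n)) ∧ (∀ n, π n ∉ F n) ∧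
      (∀ n, ∀ ι ∈ F n, Sum.elim v w ι ≤ θ n) ∧ (∀ n, ∀ ι, ι ∉ F n → θ n ≤ Sum.elim v w ι) := by
  classical
  let step : ℕ × ℕ → ℕ × ℕ := fun q => if v q.1 ≤ w q.2 then (q.1 + 1, q.2) else (q.1, q.2 + 1)
  let emit : ℕ × ℕ → ℕ ⊕ ℕ := fun q => if v q.1 ≤ w q.2 then Sum.inl q.1 else Sum.inr q.2
  let st : ℕ → ℕ × ℕ := fun n => step^[n] (0, 0)
  have hst : ∀ n, st (n + 1) = step (st n) := fun n => Function.iterate_succ_apply' step n _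
  have hinv : ∀ n, (∀ i < (st n).1, v i ≤ w (st n).2) ∧ (∀ j < (st n).2, w j ≤ v (st n).1) := by
    intro n
    induction n with
    | zero => simp [st]
    | succ n ih =>
      rw [hst]
      by_cases h : v (st n).1 ≤ w (st n).2
      · have : step (st n) = ((st n).1 + 1, (st n).2) := by simp [step, h]
        rw [this]
        refine ⟨fun i hi => ?_, fun j hj => (ih.2 j hj).trans (hv (Nat.le_succ _))⟩
        rcases Nat.lt_succ_iff_lt_or_eq.1 hi with h' | h'
        · exact ih.1 i h'
        · rw [h']; exact h
      · have : step (st n) = ((st n).1, (st n).2 + 1) := by simp [step, h]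
        rw [this]
        refine ⟨fun i hi => (ih.1 i hi).trans (hw (Nat.le_succ _)), fun j hj => ?_⟩
        rcases Nat.lt_succ_iff_lt_or_eq.1 hj with h' | h'
        · exact ih.2 j h'
        · rw [h']; exact (not_le.1 h).le
  refine ⟨fun n => emit (st n),
    fun n => (Finset.range (st n).1).disjSum (Finset.range (st n).2),
    fun n => min (v (st n).1) (w (st n).2), ?_, ?_, ?_, ?_, ?_⟩
  · simp [st]
  · intro n
    simp only [hst]
    by_cases h : v (st n).1 ≤ w (st n).2
    · simp only [step, emit, h, if_true]
      ext (i | j) <;> simp <;> omega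
    · simp only [step, emit, h, if_false]
      ext (i | j) <;> simp <;> omega
  · intro n
    by_cases h : v (st n).1 ≤ w (st n).2
    · simp [emit, h]
    · simp [emit, h]
  · rintro n (i | j) hι
    · have hi : i < (st n).1 := by simpa using hι
      exact le_min (hv hi.le) ((hinv n).1 i hi)
    · have hj : j < (st n).2 := by simpa using hι
      exact le_min ((hinv n).2 j hj) (hw hj.le)
  · rintro n (i | j) hι
    · have hi : (st n).1 ≤ i := by simpa using hι
      exact (min_le_left _ _).trans (hv hi)
    · have hj : (st n).2 ≤ j := by simpa using hι
      exact (min_le_right _ _).trans (hw hj)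

lemma bathtub {κ : Type*} (m u : κ → ℝ≥0∞) (F : Finset κ) (θ : ℝ≥0∞) (hm : ∀ i, m i ≤ 1)
    (hF : (F.card : ℝ≥0∞) ≤ ∑' i, m i) (h1 : ∀ i ∈ F, u i ≤ θ) (h2 : ∀ i, i ∉ F → θ ≤ u i) :
    ∑ i ∈ F, u i ≤ ∑' i, m i * u i := by
  have hfin : ∑ i ∈ F, m i ≠ ∞ := by
    refine ENNReal.sum_ne_top.2 fun i _ => ne_top_of_le_ne_top ENNReal.one_ne_top (hm i)
  have e1 : ∑ i ∈ F, (1 - m i) + ∑ i ∈ F, m i = F.card := by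
    rw [← Finset.sum_add_distrib]
    simp [tsub_add_cancel_of_le (hm _)]
  have key : ∑ i ∈ F, (1 - m i) ≤ ∑' i : ((F : Set κ)ᶜ : Set κ), m i := by
    rw [← ENNReal.sum_add_tsum_compl F m, ← e1, add_comm] at hF
    exact (ENNReal.add_le_add_iff_left hfin).1 hF
  rw [← ENNReal.sum_add_tsum_compl F (fun i => m i * u i)]
  calc ∑ i ∈ F, u i = ∑ i ∈ F, m i * u i + ∑ i ∈ F, (1 - m i) * u i := by
        rw [← Finset.sum_add_distrib]
        refine Finset.sum_congr rfl fun i _ => ?_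
        rw [← add_mul, add_tsub_cancel_of_le (hm i), one_mul]
    _ ≤ ∑ i ∈ F, m i * u i + ∑' i : ((F : Set κ)ᶜ : Set κ), m i * u i := by
        gcongr
        calc ∑ i ∈ F, (1 - m i) * u i ≤ ∑ i ∈ F, (1 - m i) * θ := by
              refine Finset.sum_le_sum fun i hi => ?_
              gcongr
              exact h1 i hi
          _ = (∑ i ∈ F, (1 - m i)) * θ := by rw [Finset.sum_mul]
          _ ≤ (∑' i : ((F : Set κ)ᶜ : Set κ), m i) * θ := by gcongr
          _ = ∑' i : ((F : Set κ)ᶜ : Set κ), m i * θ := by rw [ENNReal.tsum_mul_right]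
          _ ≤ _ := by
              refine ENNReal.tsum_le_tsum fun i => ?_
              gcongr
              exact h2 i i.2

lemma abel_identity (s x : ℕ → ℝ≥0∞) (hs : Antitone s) (N : ℕ) :
    ∑ n ∈ Finset.range N, s n * x n = s N * ∑ n ∈ Finset.range N, x n
      + ∑ k ∈ Finset.range N, (s k - s (k + 1)) * ∑ n ∈ Finset.range (k + 1), x n := by
  induction N with
  | zero => simp
  | succ N ih =>
    rw [Finset.sum_range_succ, ih, Finset.sum_range_succ (fun k => (s k - s (k + 1)) * _)]
    have : s N = s (N + 1) + (s N - s (N + 1)) := (add_tsub_cancel_of_le (hs (Nat.le_succ N))).symm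
    calc _ = s N * ∑ n ∈ Finset.range (N + 1), x n + ∑ k ∈ Finset.range N, (s k - s (k + 1)) * ∑ n ∈ Finset.range (k + 1), x n := by
          rw [Finset.sum_range_succ x, mul_add]; ring
      _ = (s (N + 1) + (s N - s (N + 1))) * ∑ n ∈ Finset.range (N + 1), x n + ∑ k ∈ Finset.range N, (s k - s (k + 1)) * ∑ n ∈ Finset.range (k + 1), x n := by rw [← this]
      _ = _ := by rw [add_mul]; ring

lemma abel_enn (s x y : ℕ → ℝ≥0∞) (hs : Antitone s)
    (h : ∀ N, ∑ n ∈ Finset.range N, x n ≤ ∑ n ∈ Finset.range N, y n) (N : ℕ) :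
    ∑ n ∈ Finset.range N, s n * x n ≤ ∑ n ∈ Finset.range N, s n * y n := by
  rw [abel_identity s x hs, abel_identity s y hs]
  refine add_le_add (mul_le_mul_right (h N) _) (Finset.sum_le_sum fun k _ => mul_le_mul_right (h _) _)

lemma weight_exists (p : ℝ) (hp0 : 0 < p) (hp1 : p < 1) (α : ℕ → ℝ≥0∞) (hα : Antitone α)
    (hQ : ∑' n, α n ^ p ≠ ∞) :
    ∃ v : ℕ → ℝ≥0∞, Monotone v ∧ ∑' i, α i * v i ≤ (∑' n, α n ^ p) ^ (1 / p) ∧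
      ∀ (S : Set ℕ) (σ : ℕ → ℕ) (γ : ℕ → ℝ≥0∞), Set.InjOn σ S →
        (∑' n, (S.indicator γ n) ^ p) ^ (1 / p) ≤ ∑' n, S.indicator (fun n => γ n * v (σ n)) n := by
  classical
  by_cases hQ0 : ∑' n, α n ^ p = 0
  · have hα0 : ∀ n, α n = 0 := fun n => by
      have := (ENNReal.tsum_eq_zero.1 hQ0) n
      rcases ENNReal.rpow_eq_zero_iff.1 this with h | h
      · exact h.1
      · linarith [h.2]
    refine ⟨fun _ => ∞, fun _ _ _ => le_rfl, by simp [hα0], fun S σ γ _ => ?_⟩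
    by_cases h : ∀ n, S.indicator γ n = 0
    · simp [h, ENNReal.zero_rpow_of_pos hp0, ENNReal.zero_rpow_of_pos (inv_pos.2 hp0)]
    · push Not at h
      obtain ⟨n, hn⟩ := h
      have hnS : n ∈ S := by by_contra h; simp [h] at hn
      have : ∑' n, S.indicator (fun n => γ n * ∞) n = ∞ := by
        refine ENNReal.tsum_eq_top_of_eq_top ⟨n, ?_⟩
        simp only [Set.indicator_of_mem hnS] at hn ⊢
        exact ENNReal.mul_top hn
      rw [this]; exact le_top
  set Q := ∑' n, α n ^ p with hQdef
  have hαt : ∀ n, α n ≠ ∞ := fun n h => by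
    refine ENNReal.ne_top_of_tsum_ne_top hQ n ?_
    rw [h, ENNReal.top_rpow_of_pos hp0]
  have hQc0 : Q ^ ((1 - p) / p) ≠ 0 := by
    intro h
    rcases ENNReal.rpow_eq_zero_iff.1 h with h | h
    · exact hQ0 h.1
    · exact hQ h.1
  refine ⟨fun i => Q ^ ((1 - p) / p) * α i ^ (p - 1), fun i j hij => ?_, ?_, fun S σ γ hσ => ?_⟩
  · dsimp only
    gcongr 1
    have e : p - 1 = -(1 - p) := by ring
    rw [e, ENNReal.rpow_neg, ENNReal.rpow_neg, ENNReal.inv_le_inv]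
    exact ENNReal.rpow_le_rpow (hα hij) (by linarith)
  · calc ∑' i, α i * (Q ^ ((1 - p) / p) * α i ^ (p - 1)) ≤ ∑' i, Q ^ ((1 - p) / p) * α i ^ p := by
          refine ENNReal.tsum_le_tsum fun i => ?_
          rw [mul_left_comm]
          gcongr
          by_cases h : α i = 0
          · simp [h]
          · nth_rewrite 1 [← ENNReal.rpow_one (α i)]
            rw [← ENNReal.rpow_add _ _ h (hαt i)]
            simp
      _ = Q ^ ((1 - p) / p) * Q ^ (1 : ℝ) := by rw [ENNReal.tsum_mul_left, ENNReal.rpow_one]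
      _ ≤ Q ^ (1 / p) := by
          rw [← ENNReal.rpow_add _ _ hQ0 hQ]
          refine le_of_eq ?_
          congr 1
          field_simp
          ring
  · by_cases htop : ∑' n, S.indicator (fun n => γ n * (Q ^ ((1 - p) / p) * α (σ n) ^ (p - 1))) n = ∞
    · rw [htop]; exact le_top
    set f : ℕ → ℝ≥0∞ := S.indicator (fun n => γ n * α (σ n) ^ (p - 1)) with hf
    set g : ℕ → ℝ≥0∞ := S.indicator (fun n => α (σ n) ^ p) with hg
    have hfs : ∑' n, S.indicator (fun n => γ n * (Q ^ ((1 - p) / p) * α (σ n) ^ (p - 1))) n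
        = Q ^ ((1 - p) / p) * ∑' n, f n := by
      rw [← ENNReal.tsum_mul_left]
      refine tsum_congr fun n => ?_
      by_cases hn : n ∈ S
      · simp only [hf, Set.indicator_of_mem hn]; ring
      · simp [hf, hn]
    have hgs : ∑' n, g n ≤ Q := by
      rw [hg, ← tsum_subtype S (fun n => α (σ n) ^ p)]
      have hinj : Function.Injective (fun n : S => σ n) := fun a b h => Subtype.ext (hσ a.2 b.2 h)
      exact ENNReal.tsum_comp_le_tsum_of_injective hinj (fun n => α n ^ p)
    have hpt : ∀ n, (S.indicator γ n) ^ p ≤ f n ^ p * g n ^ (1 - p) := by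
      intro n
      by_cases hn : n ∈ S
      · simp only [hf, hg, Set.indicator_of_mem hn]
        by_cases h : α (σ n) = 0
        · have hγ : γ n = 0 := by
            by_contra hγ
            refine htop (ENNReal.tsum_eq_top_of_eq_top ⟨n, ?_⟩)
            rw [Set.indicator_of_mem hn, h, ENNReal.zero_rpow_of_neg (by linarith),
              ENNReal.mul_top hQc0, ENNReal.mul_top hγ]
          rw [hγ, ENNReal.zero_rpow_of_pos hp0]
          exact zero_le
        · rw [ENNReal.mul_rpow_of_nonneg _ _ hp0.le, mul_assoc, ← ENNReal.rpow_mul, ← ENNReal.rpow_mul,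
            ← ENNReal.rpow_add _ _ h (hαt _)]
          have : (p - 1) * p + p * (1 - p) = 0 := by ring
          rw [this, ENNReal.rpow_zero, mul_one]
      · simp [hn, ENNReal.zero_rpow_of_pos hp0]
    have hold : ∑' n, f n ^ p * g n ^ (1 - p) ≤ (∑' n, f n) ^ p * (∑' n, g n) ^ (1 - p) := by
      have := ENNReal.lintegral_mul_norm_pow_le (μ := (Measure.count : Measure ℕ)) (f := f) (g := g)
        (measurable_of_countable f).aemeasurable (measurable_of_countable g).aemeasurable
        hp0.le (sub_nonneg.2 hp1.le) (by ring)
      simpa only [lintegral_count] using this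
    calc (∑' n, (S.indicator γ n) ^ p) ^ (1 / p) ≤ ((∑' n, f n) ^ p * Q ^ (1 - p)) ^ (1 / p) := by
          refine ENNReal.rpow_le_rpow ?_ (by positivity)
          refine (ENNReal.tsum_le_tsum hpt).trans (hold.trans ?_)
          gcongr
      _ = _ := by
          rw [hfs, ENNReal.mul_rpow_of_nonneg _ _ (by positivity), ← ENNReal.rpow_mul,
            ← ENNReal.rpow_mul, mul_one_div_cancel hp0.ne', ENNReal.rpow_one, mul_comm, mul_one_div]

lemma seqB (t : ℝ) (ht : 0 < t) (p₀ p₁ : ℝ≥0∞) (hp₀ : 0 < p₀) (hp₀' : p₀ < 1) (hp₁ : 0 < p₁)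
    (hp₁' : p₁ < 1) (s α β : ℕ → ℝ) (hs : ∀ n, 0 ≤ s n) (hα : ∀ n, 0 ≤ α n) (hβ : ∀ n, 0 ≤ β n)
    (hsa : Antitone s) (hαa : Antitone α) (hβa : Antitone β) (M : ℕ ⊕ ℕ → ℕ → ℝ≥0∞)
    (h1 : ∀ ι, ∑' n, M ι n ≤ 1) (h2 : ∀ n, s n ≠ 0 → ∑' ι, M ι n = 1)
    (h3 : ∀ ι, ∑' n, M ι n * ENNReal.ofReal (s n) ≤ ENNReal.ofReal (Sum.elim α β ι)) :
    Kseq t p₀ p₁ s ≤ eLpNorm α p₀ Measure.count + ENNReal.ofReal t * eLpNorm β p₁ Measure.count := by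
  classical
  have hp₀t : p₀ ≠ ∞ := (hp₀'.trans ENNReal.one_lt_top).ne
  have hp₁t : p₁ ≠ ∞ := (hp₁'.trans ENNReal.one_lt_top).ne
  have q0 : 0 < p₀.toReal := ENNReal.toReal_pos hp₀.ne' hp₀t
  have q1 : 0 < p₁.toReal := ENNReal.toReal_pos hp₁.ne' hp₁t
  have q0' : p₀.toReal < 1 := by
    rw [← ENNReal.toReal_one]; exact (ENNReal.toReal_lt_toReal hp₀t ENNReal.one_ne_top).2 hp₀'
  have q1' : p₁.toReal < 1 := by
    rw [← ENNReal.toReal_one]; exact (ENNReal.toReal_lt_toReal hp₁t ENNReal.one_ne_top).2 hp₁'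
  have ht0 : ENNReal.ofReal t ≠ 0 := by simpa using ht
  have hen : ∀ (b : ℕ → ℝ), (∀ n, 0 ≤ b n) → ∀ n, ‖b n‖ₑ = ENNReal.ofReal (b n) :=
    fun b hb n => Real.enorm_of_nonneg (hb n)
  have eα := eLpNorm_count α p₀ hp₀.ne' hp₀t
  have eβ := eLpNorm_count β p₁ hp₁.ne' hp₁t
  simp only [hen α hα] at eα
  simp only [hen β hβ] at eβ
  by_cases hQα : ∑' n, ENNReal.ofReal (α n) ^ p₀.toReal = ∞
  · rw [eα, hQα, ENNReal.top_rpow_of_pos (by positivity), top_add]; exact le_top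
  by_cases hQβ : ∑' n, ENNReal.ofReal (β n) ^ p₁.toReal = ∞
  · rw [eβ, hQβ, ENNReal.top_rpow_of_pos (by positivity), ENNReal.mul_top ht0, add_top]; exact le_top
  obtain ⟨v, hvm, hvα, hv⟩ := weight_exists p₀.toReal q0 q0' (fun n => ENNReal.ofReal (α n))
    (fun i j hij => ENNReal.ofReal_le_ofReal (hαa hij)) hQα
  obtain ⟨w, hwm, hwβ, hw⟩ := weight_exists p₁.toReal q1 q1' (fun n => ENNReal.ofReal (β n))
    (fun i j hij => ENNReal.ofReal_le_ofReal (hβa hij)) hQβ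
  obtain ⟨π, F, θ, hF0, hFs, hπ, hle, hge⟩ := merge_exists v (fun j => ENNReal.ofReal t * w j) hvm
    (fun i j hij => mul_le_mul_right (hwm hij) _)
  set u : ℕ ⊕ ℕ → ℝ≥0∞ := Sum.elim v (fun j => ENNReal.ofReal t * w j) with hu
  have hcard : ∀ N, (F N).card = N := by
    intro N
    induction N with
    | zero => simp [hF0]
    | succ N ih => rw [hFs, Finset.card_insert_of_notMem (hπ N), ih]
  have hsumF : ∀ N, ∑ n ∈ Finset.range N, u (π n) = ∑ ι ∈ F N, u ι := by
    intro N
    induction N with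
    | zero => simp [hF0]
    | succ N ih => rw [hFs, Finset.sum_insert (hπ N), Finset.sum_range_succ, ih, add_comm]
  have hmem : ∀ m n, m < n → π m ∈ F n := by
    intro m n hmn
    induction n with
    | zero => omega
    | succ n ih =>
      rw [hFs, Finset.mem_insert]
      rcases Nat.lt_succ_iff_lt_or_eq.1 hmn with h | h
      · exact Or.inr (ih h)
      · left; rw [h]
  have hπinj : Function.Injective π := by
    intro m n hmn
    by_contra hne
    rcases lt_or_gt_of_ne hne with h | h
    · exact hπ n (hmn ▸ hmem m n h)
    · exact hπ m (hmn ▸ hmem n m h)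
  set T : ℕ → ℝ≥0∞ := fun n => ENNReal.ofReal (s n) with hT
  have hTa : Antitone T := fun i j hij => ENNReal.ofReal_le_ofReal (hsa hij)
  set c : ℕ → ℝ≥0∞ := fun n => if s n = 0 then ∞ else ∑' ι, M ι n * u ι with hc
  have hpre : ∀ N, ∑ n ∈ Finset.range N, u (π n) ≤ ∑ n ∈ Finset.range N, c n := by
    intro N
    by_cases hz : ∃ n ∈ Finset.range N, s n = 0
    · obtain ⟨n, hn, hn0⟩ := hz
      have : ∑ n ∈ Finset.range N, c n = ∞ := ENNReal.sum_eq_top.2 ⟨n, hn, by simp [hc, hn0]⟩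
      rw [this]; exact le_top
    · push Not at hz
      rw [hsumF]
      have hb := bathtub (fun ι => ∑ n ∈ Finset.range N, M ι n) u (F N) (θ N)
        (fun ι => (ENNReal.sum_le_tsum _).trans (h1 ι)) ?_ (hle N) (hge N)
      · refine hb.trans (le_of_eq ?_)
        simp only [Finset.sum_mul]
        rw [Summable.tsum_finsetSum (fun _ _ => ENNReal.summable)]
        refine Finset.sum_congr rfl fun n hn => ?_
        simp [hc, hz n hn]
      · rw [Summable.tsum_finsetSum (fun _ _ => ENNReal.summable), hcard,
          Finset.sum_congr rfl fun n hn => h2 n (hz n hn)]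
        simp
  have hab := abel_enn T (fun n => u (π n)) c hTa hpre
  have hmain : ∑' n, T n * u (π n) ≤ eLpNorm α p₀ Measure.count
      + ENNReal.ofReal t * eLpNorm β p₁ Measure.count := by
    calc ∑' n, T n * u (π n) ≤ ∑' n, T n * c n := by
          rw [ENNReal.tsum_eq_iSup_nat, ENNReal.tsum_eq_iSup_nat]
          exact iSup_mono hab
      _ ≤ ∑' n, ∑' ι, u ι * (M ι n * T n) := by
          refine ENNReal.tsum_le_tsum fun n => ?_
          by_cases hn : s n = 0
          · simp [hT, hn]
          · simp only [hc, hn, if_false]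
            rw [← ENNReal.tsum_mul_left]
            exact ENNReal.tsum_le_tsum fun ι => le_of_eq (by ring)
      _ = ∑' ι, u ι * ∑' n, M ι n * T n := by
          rw [ENNReal.tsum_comm]
          simp only [ENNReal.tsum_mul_left]
      _ ≤ ∑' ι, u ι * ENNReal.ofReal (Sum.elim α β ι) :=
          ENNReal.tsum_le_tsum fun ι => mul_le_mul_right (h3 ι) _
      _ = ∑' i, ENNReal.ofReal (α i) * v i + ENNReal.ofReal t * ∑' i, ENNReal.ofReal (β i) * w i := by
          rw [Summable.tsum_sum ENNReal.summable ENNReal.summable, ← ENNReal.tsum_mul_left]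
          simp only [hu, Sum.elim_inl, Sum.elim_inr]
          congr 1
          · exact tsum_congr fun i => mul_comm _ _
          · exact tsum_congr fun i => by ring
      _ ≤ _ := by
          rw [eα, eβ]
          exact add_le_add hvα (mul_le_mul_right hwβ _)
  refine le_trans ?_ hmain
  set S : Set ℕ := {n | (π n).isLeft} with hS
  set b₀ : ℕ → ℝ := S.indicator s with hb₀
  set b₁ : ℕ → ℝ := Sᶜ.indicator s with hb₁
  have hsplit : s = b₀ + b₁ := (Set.indicator_self_add_compl S s).symm
  have hK : Kseq t p₀ p₁ s ≤ eLpNorm b₀ p₀ Measure.count + ENNReal.ofReal t * eLpNorm b₁ p₁ Measure.count := by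
    conv_lhs => rw [hsplit]
    exact Kseq_le t p₀ p₁ b₀ b₁
  refine hK.trans ?_
  have ind : ∀ (R : Set ℕ) n, ‖R.indicator s n‖ₑ = R.indicator T n := by
    intro R n
    by_cases h : n ∈ R
    · simp only [Set.indicator_of_mem h]; exact hen s hs n
    · simp [h]
  rw [eLpNorm_count b₀ p₀ hp₀.ne' hp₀t, eLpNorm_count b₁ p₁ hp₁.ne' hp₁t]
  simp only [hb₀, hb₁, ind]
  let σ₀ : ℕ → ℕ := fun n => Sum.elim id id (π n)
  have hS₀ : ∀ n ∈ S, π n = Sum.inl (σ₀ n) := by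
    intro n hn
    obtain ⟨y, hy⟩ := Sum.isLeft_iff.1 hn
    simp [σ₀, hy]
  have hS₁ : ∀ n ∈ Sᶜ, π n = Sum.inr (σ₀ n) := by
    intro n hn
    have hn' : (π n).isRight := by simpa [hS] using hn
    obtain ⟨y, hy⟩ := Sum.isRight_iff.1 hn'
    simp [σ₀, hy]
  have i0 := hv S σ₀ T (fun a ha b hb hab => hπinj (by rw [hS₀ a ha, hS₀ b hb, hab]))
  have i1 := hw Sᶜ σ₀ T (fun a ha b hb hab => hπinj (by rw [hS₁ a ha, hS₁ b hb, hab]))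
  refine (add_le_add i0 (mul_le_mul_right i1 _)).trans (le_of_eq ?_)
  rw [← ENNReal.tsum_mul_left, ← ENNReal.tsum_add]
  refine tsum_congr fun n => ?_
  by_cases hn : n ∈ S
  · have hn' : n ∉ Sᶜ := fun h => h hn
    rw [Set.indicator_of_mem hn, Set.indicator_of_notMem hn', hS₀ n hn]
    simp [hu]
  · have hn' : n ∈ Sᶜ := hn
    rw [Set.indicator_of_notMem hn, Set.indicator_of_mem hn', hS₁ n hn']
    simp only [hu, Sum.elim_inr, zero_add]
    ring

/-! ### the case `p₁ < 1`: operators -/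

lemma row_bound {B G : H →L[ℂ] H} {e g : ℕ → H} (hB : Spec B e) (hG : Spec G g)
    (h : ∀ v, (inner ℂ (B v) v).re ≤ (inner ℂ (G v) v).re) (i : ℕ) (F : Finset ℕ) :
    ∑ n ∈ F, singNum B i * ‖inner ℂ (g n) (e i)‖ ^ 2 / singNum G n ≤ 1 := by
  classical
  set q : ℝ := ∑ n ∈ F, ‖inner ℂ (g n) (e i)‖ ^ 2 / singNum G n with hq
  have hq0 : 0 ≤ q := Finset.sum_nonneg fun n _ => div_nonneg (sq_nonneg _) (singNum_nonneg _ _)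
  have hα := singNum_nonneg B i
  have hsum : ∑ n ∈ F, singNum B i * ‖inner ℂ (g n) (e i)‖ ^ 2 / singNum G n = singNum B i * q := by
    rw [hq, Finset.mul_sum]
    exact Finset.sum_congr rfl fun n _ => by rw [mul_div_assoc]
  rw [hsum]
  let c : ℕ → ℂ := fun n => inner ℂ (g n) (e i) / (singNum G n : ℂ)
  set y : H := ∑ n ∈ F, c n • g n with hy
  have h1 : inner ℂ (e i) y = (q : ℂ) := by
    rw [hy, _root_.inner_sum, hq, Complex.ofReal_sum]
    refine Finset.sum_congr rfl fun n _ => ?_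
    rw [inner_smul_right, ← inner_conj_symm (e i) (g n)]
    simp only [c]
    rw [div_mul_eq_mul_div, Complex.mul_conj, Complex.normSq_eq_norm_sq]
    push_cast
    rfl
  have h2 : (inner ℂ (G y) y).re = q := by
    refine (hG.form y).unique ?_
    have hterm : ∀ n ∈ F, singNum G n * ‖inner ℂ (g n) y‖ ^ 2
        = ‖inner ℂ (g n) (e i)‖ ^ 2 / singNum G n := by
      intro n hn
      by_cases hn0 : singNum G n = 0
      · simp [hn0]
      · rw [hy, hG.oz.inner_sum F c n hn (hG.unit n hn0)]
        simp only [c]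
        rw [norm_div, Complex.norm_real, Real.norm_of_nonneg (singNum_nonneg G n)]
        field_simp
    rw [hq, ← Finset.sum_congr rfl hterm]
    refine hasSum_sum_of_ne_finset_zero fun n hn => ?_
    have : inner ℂ (g n) y = 0 := by
      rw [hy, _root_.inner_sum]
      refine Finset.sum_eq_zero fun m hm => ?_
      rw [inner_smul_right, hG.oz.orth n m (fun h => hn (h ▸ hm)), mul_zero]
    simp [this]
  have h3 : singNum B i * q ^ 2 ≤ (inner ℂ (B y) y).re := by
    have := le_hasSum (hB.form y) i (fun j _ => mul_nonneg (singNum_nonneg B j) (sq_nonneg _))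
    rwa [h1, Complex.norm_real, Real.norm_of_nonneg hq0] at this
  have h4 := h3.trans (h y)
  rw [h2] at h4
  rcases hq0.eq_or_lt with h0 | h0
  · rw [← h0]; simp
  · have : singNum B i * q * q ≤ 1 * q := by
      rw [mul_assoc, ← pow_two, one_mul]; exact h4
    exact le_of_mul_le_mul_right this h0

lemma row_tsum {B G : H →L[ℂ] H} {e g : ℕ → H} (hB : Spec B e) (hG : Spec G g)
    (h : ∀ v, (inner ℂ (B v) v).re ≤ (inner ℂ (G v) v).re) (i : ℕ) :
    ∑' n, ENNReal.ofReal (singNum B i * ‖inner ℂ (g n) (e i)‖ ^ 2 / singNum G n) ≤ 1 := by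
  rw [ENNReal.tsum_eq_iSup_sum]
  refine iSup_le fun F => ?_
  rw [← ENNReal.ofReal_sum_of_nonneg fun n _ =>
    div_nonneg (mul_nonneg (singNum_nonneg _ _) (sq_nonneg _)) (singNum_nonneg _ _)]
  exact ENNReal.ofReal_le_one.2 (row_bound hB hG h i F)

lemma row_weight {B G : H →L[ℂ] H} {e g : ℕ → H} (hB : Spec B e) (hG : Spec G g) (i : ℕ) :
    ∑' n, ENNReal.ofReal (singNum B i * ‖inner ℂ (g n) (e i)‖ ^ 2 / singNum G n)
      * ENNReal.ofReal (singNum G n) ≤ ENNReal.ofReal (singNum B i) := by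
  rw [ENNReal.tsum_eq_iSup_sum]
  refine iSup_le fun F => ?_
  have h1 : ∀ n ∈ F, ENNReal.ofReal (singNum B i * ‖inner ℂ (g n) (e i)‖ ^ 2 / singNum G n)
      * ENNReal.ofReal (singNum G n) ≤ ENNReal.ofReal (singNum B i * ‖inner ℂ (g n) (e i)‖ ^ 2) := by
    intro n _
    have hnn : 0 ≤ singNum B i * ‖inner ℂ (g n) (e i)‖ ^ 2 :=
      mul_nonneg (singNum_nonneg _ _) (sq_nonneg _)
    rw [← ENNReal.ofReal_mul (div_nonneg hnn (singNum_nonneg _ _))]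
    refine ENNReal.ofReal_le_ofReal ?_
    by_cases h0 : singNum G n = 0
    · rw [h0]; simpa using hnn
    · rw [div_mul_cancel₀ _ h0]
  refine (Finset.sum_le_sum h1).trans ?_
  rw [← ENNReal.ofReal_sum_of_nonneg fun n _ => mul_nonneg (singNum_nonneg _ _) (sq_nonneg _),
    ← Finset.mul_sum]
  refine ENNReal.ofReal_le_ofReal (mul_le_of_le_one_right (singNum_nonneg _ _) ?_)
  exact (hG.oz.bessel _ _).trans (pow_le_one₀ (norm_nonneg _) (hB.oz.norm_le i))

lemma col_tsum {B G : H →L[ℂ] H} {e : ℕ → H} (g : ℕ → H) (hB : Spec B e) (n : ℕ) :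
    ∑' i, ENNReal.ofReal (singNum B i * ‖inner ℂ (g n) (e i)‖ ^ 2 / singNum G n)
      = ENNReal.ofReal ((inner ℂ (B (g n)) (g n)).re / singNum G n) := by
  have h1 := (hB.form (g n)).div_const (singNum G n)
  rw [← h1.tsum_eq, ENNReal.ofReal_tsum_of_nonneg (fun i =>
    div_nonneg (mul_nonneg (singNum_nonneg _ _) (sq_nonneg _)) (singNum_nonneg _ _)) h1.summable]
  refine tsum_congr fun i => ?_
  rw [norm_inner_symm]

lemma Kseq_le_caseB (t : ℝ) (ht : 0 < t) (p₀ p₁ : ℝ≥0∞) (hp₀ : 0 < p₀) (hp : p₀ ≤ p₁) (hp₁ : p₁ < 1)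
    {A B C : H →L[ℂ] H} (hA : A.IsPositive) (hAc : IsCompactOperator (⇑A))
    (hB : B.IsPositive) (hBc : IsCompactOperator (⇑B))
    (hC : C.IsPositive) (hCc : IsCompactOperator (⇑C))
    (h : ∀ v, (inner ℂ (A v) v).re ≤ (inner ℂ (B v) v).re + (inner ℂ (C v) v).re) :
    Kseq t p₀ p₁ (singNum A) ≤ schattenNorm p₀ B + ENNReal.ofReal t * schattenNorm p₁ C := by
  obtain ⟨a, ha⟩ := exists_spec A hA hAc
  obtain ⟨e, he⟩ := exists_spec B hB hBc
  obtain ⟨f, hf⟩ := exists_spec C hC hCc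
  obtain ⟨g, hg⟩ := exists_spec (B + C) (hB.add hC) (hBc.add hCc)
  have hform : ∀ v, (inner ℂ ((B + C) v) v).re = (inner ℂ (B v) v).re + (inner ℂ (C v) v).re := by
    intro v
    rw [ContinuousLinearMap.add_apply, inner_add_left, Complex.add_re]
  have hB0 : ∀ v, 0 ≤ (inner ℂ (B v) v).re := fun v =>
    (he.form v).nonneg fun n => mul_nonneg (singNum_nonneg _ _) (sq_nonneg _)
  have hC0 : ∀ v, 0 ≤ (inner ℂ (C v) v).re := fun v =>
    (hf.form v).nonneg fun n => mul_nonneg (singNum_nonneg _ _) (sq_nonneg _)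
  have hAG : ∀ n, singNum A n ≤ singNum (B + C) n := fun n =>
    ha.le_of_form _ n fun _ v _ => by rw [hform]; exact h v
  refine (Kseq_mono t p₀ p₁ _ _ (singNum_nonneg A) hAG).trans ?_
  refine seqB t ht p₀ p₁ hp₀ (hp.trans_lt hp₁) (hp₀.trans_le hp) hp₁ _ _ _ (singNum_nonneg _)
    (singNum_nonneg _) (singNum_nonneg _) (singNum_antitone _) (singNum_antitone _)
    (singNum_antitone _)
    (Sum.elim
      (fun i n => ENNReal.ofReal (singNum B i * ‖inner ℂ (g n) (e i)‖ ^ 2 / singNum (B + C) n))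
      (fun i n => ENNReal.ofReal (singNum C i * ‖inner ℂ (g n) (f i)‖ ^ 2 / singNum (B + C) n)))
    ?_ ?_ ?_
  · rintro (i | i)
    · exact row_tsum he hg (fun v => by rw [hform]; linarith [hC0 v]) i
    · exact row_tsum hf hg (fun v => by rw [hform]; linarith [hB0 v]) i
  · intro n hn
    rw [Summable.tsum_sum ENNReal.summable ENNReal.summable]
    simp only [Sum.elim_inl, Sum.elim_inr]
    rw [col_tsum g he n, col_tsum g hf n,
      ← ENNReal.ofReal_add (div_nonneg (hB0 _) (singNum_nonneg _ _))
        (div_nonneg (hC0 _) (singNum_nonneg _ _)), ← add_div, ← hform, hg.form_eig, div_self hn,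
      ENNReal.ofReal_one]
  · rintro (i | i)
    · exact row_weight he hg i
    · exact row_weight hf hg i

lemma Kseq_le_Kschatten (t : ℝ) (ht : 0 < t) (p₀ p₁ : ℝ≥0∞) (hp₀ : 0 < p₀) (hp : p₀ ≤ p₁)
    {A : H →L[ℂ] H} (hA : A.IsPositive) (hAc : IsCompactOperator (⇑A)) :
    Kseq t p₀ p₁ (singNum A) ≤ Kschatten t p₀ p₁ A := by
  refine le_sInf ?_
  rintro _ ⟨x₀, x₁, hx, h0, h1, rfl⟩
  obtain ⟨B, hB, hBc, hBf, hBs⟩ := exists_majorant x₀ h0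
  obtain ⟨C, hC, hCc, hCf, hCs⟩ := exists_majorant x₁ h1
  have hmono : ∀ (p : ℝ≥0∞) (X Y : H →L[ℂ] H), (∀ n, singNum X n ≤ singNum Y n) →
      schattenNorm p X ≤ schattenNorm p Y := by
    intro p X Y hXY
    refine eLpNorm_mono fun n => ?_
    rw [Real.norm_of_nonneg (singNum_nonneg _ _), Real.norm_of_nonneg (singNum_nonneg _ _)]
    exact hXY n
  have hf : ∀ v, (inner ℂ (A v) v).re ≤ (inner ℂ (B v) v).re + (inner ℂ (C v) v).re := by
    intro v
    rw [hx, ContinuousLinearMap.add_apply, inner_add_left, Complex.add_re]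
    exact add_le_add (hBf v) (hCf v)
  refine le_trans ?_ (add_le_add (hmono p₀ B x₀ hBs) (mul_le_mul_right (hmono p₁ C x₁ hCs) _))
  by_cases h : 1 ≤ p₁
  · exact Kseq_le_caseA t p₀ p₁ h hA hAc hB hBc hC hCc hf
  · exact Kseq_le_caseB t ht p₀ p₁ hp₀ hp (not_le.1 h) hA hAc hB hBc hC hCc hf

/-- Let `H` be a Hilbert space, `0 < p₀ ≤ p₁ ≤ ∞` and `x ∈ C_{p₀} + C_{p₁}`.  Then for all
`t > 0`, `K_t(x, C_{p₀}, C_{p₁}) = K_t(|x|, C_{p₀}, C_{p₁}) = K_t(λ(|x|), ℓ_{p₀}, ℓ_{p₁})`,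
where `λ(|x|)` is the nonincreasing sequence of eigenvalues of `|x| = (x* x)^{1/2}`. -/
theorem Kfunctional_schatten_eq (p₀ p₁ : ℝ≥0∞) (hp₀ : 0 < p₀) (hp : p₀ ≤ p₁)
    (x : H →L[ℂ] H)
    (hx : ∃ x₀ x₁ : H →L[ℂ] H, x = x₀ + x₁ ∧
      IsCompactOperator (⇑x₀) ∧ schattenNorm p₀ x₀ < ∞ ∧
      IsCompactOperator (⇑x₁) ∧ schattenNorm p₁ x₁ < ∞) :
    ∀ t : ℝ, 0 < t →
      Kschatten t p₀ p₁ x = Kschatten t p₀ p₁ (absCLM x) ∧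
      Kschatten t p₀ p₁ x = Kseq t p₀ p₁ (singNum (absCLM x)) := by
  intro t ht
  obtain ⟨x₀, x₁, rfl, h0, -, h1, -⟩ := hx
  have hc : IsCompactOperator (⇑(x₀ + x₁)) := h0.add h1
  rw [absCLM_eq]
  refine ⟨Kschatten_abs t p₀ p₁ _, ?_⟩
  rw [Kschatten_abs]
  exact le_antisymm (Kschatten_le_Kseq t p₀ p₁ _ (abs_isPositive _) (abs_compact hc))
    (Kseq_le_Kschatten t ht p₀ p₁ hp₀ hp (abs_isPositive _) (abs_compact hc))
end
end

section
/- Let 1 ≤ q, s, r ≤ ∞ with 1/q = 1/r + 1/s, and let B be a Banach space. Then every f in the unit ball of H^q(B) with ‖f‖ ≤ 1 can be factored (in the limit sense) as f = F·φ where F is a scalar analytic function on the disc with |F(e^{it})| = ‖f(e^{it})‖_B a.e. (so ‖F‖_{H^q} ≤ 1) and φ is a B-valued analytic function with ‖φ(z)‖_B ≤ 1 for all z in the disc. In particular, for f ∈ H¹(B) one has K_t(f, H¹(B), H^∞(B)) ≤ K_t(F, H¹, H^∞) for all t > 0. -/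
noncomputable section

open MeasureTheory Real Set Metric
open scoped ENNReal

/-- The Hardy `H^p` norm of a `B`-valued function on the unit disc:
`sup_{0<r<1} ((1/2π)∫₀^{2π} ‖f(r e^{iθ})‖^p dθ)^{1/p}` (for `p = ∞`, the sup norm over the
disc). -/
def hardyNorm {B : Type*} [NormedAddCommGroup B] (p : ℝ≥0∞) (f : ℂ → B) : ℝ≥0∞ :=
  if p = ∞ then ⨆ z ∈ ball (0 : ℂ) 1, (‖f z‖₊ : ℝ≥0∞)
  else ⨆ r ∈ Ioo (0 : ℝ) 1, ENNReal.ofReal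
    (((1 / (2 * π)) * ∫ θ in (0:ℝ)..(2 * π),
      ‖f ((r : ℂ) * Complex.exp (θ * Complex.I))‖ ^ p.toReal) ^ (1 / p.toReal))

/-- The K-functional of the couple `(H^{p₀}(B), H^{p₁}(B))` of Hardy spaces of `B`-valued
analytic functions on the unit disc. -/
def KHdisc {B : Type*} [NormedAddCommGroup B] [NormedSpace ℂ B]
    (t : ℝ) (p₀ p₁ : ℝ≥0∞) (f : ℂ → B) : ℝ≥0∞ :=
  sInf {c : ℝ≥0∞ | ∃ f₀ f₁ : ℂ → B,
    (∀ z ∈ ball (0 : ℂ) 1, f z = f₀ z + f₁ z) ∧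
    DifferentiableOn ℂ f₀ (ball (0 : ℂ) 1) ∧ DifferentiableOn ℂ f₁ (ball (0 : ℂ) 1) ∧
    hardyNorm p₀ f₀ < ∞ ∧ hardyNorm p₁ f₁ < ∞ ∧
    c = hardyNorm p₀ f₀ + ENNReal.ofReal t * hardyNorm p₁ f₁}

open Filter Topology

lemma hfv_trig (g : C(AddCircle (2 * π), ℂ))
    (hg : g ∈ Submodule.span ℂ (range <| @fourier (2 * π))) :
    ∃ P Q : ℂ → ℂ, Differentiable ℂ P ∧ Differentiable ℂ Q ∧
      ∀ θ : ℝ, g (θ : AddCircle (2 * π)) = P (Complex.exp (θ * Complex.I))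
        + (starRingEnd ℂ) (Q (Complex.exp (θ * Complex.I))) := by
  have hpi : (π : ℂ) ≠ 0 := by exact_mod_cast Real.pi_ne_zero
  induction hg using Submodule.span_induction with
  | mem x hx =>
    obtain ⟨n, rfl⟩ := hx
    rcases Int.le_total 0 n with hn | hn
    · lift n to ℕ using hn
      refine ⟨fun z => z ^ n, fun _ => 0, by fun_prop, by fun_prop, fun θ => ?_⟩
      simp only
      rw [fourier_coe_apply, ← Complex.exp_nat_mul]
      simp only [map_zero, add_zero]
      congr 1
      push_cast
      field_simp
    · obtain ⟨m, rfl⟩ : ∃ m : ℕ, n = -(m:ℤ) := ⟨n.natAbs, by omega⟩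
      refine ⟨fun _ => 0, fun z => z ^ m, by fun_prop, by fun_prop, fun θ => ?_⟩
      simp only
      rw [fourier_coe_apply, ← Complex.exp_nat_mul, ← Complex.exp_conj]
      simp only [zero_add, map_mul, Complex.conj_I, Complex.conj_ofReal, map_natCast]
      congr 1
      push_cast
      field_simp
  | zero => exact ⟨fun _ => 0, fun _ => 0, by fun_prop, by fun_prop, fun θ => by simp⟩
  | add x y _ _ hx hy =>
    obtain ⟨P, Q, hP, hQ, h⟩ := hx
    obtain ⟨P', Q', hP', hQ', h'⟩ := hy
    refine ⟨fun z => P z + P' z, fun z => Q z + Q' z, hP.add hP', hQ.add hQ', fun θ => ?_⟩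
    simp only [ContinuousMap.add_apply, h, h', map_add]
    ring
  | smul a x _ hx =>
    obtain ⟨P, Q, hP, hQ, h⟩ := hx
    refine ⟨fun z => a * P z, fun z => (starRingEnd ℂ) a * Q z, hP.const_mul _, hQ.const_mul _,
      fun θ => ?_⟩
    simp only [ContinuousMap.smul_apply, h, map_mul, smul_eq_mul, Complex.conj_conj]
    ring

lemma hfv_approx (v : ℂ → ℝ) (hv : ContinuousOn v (sphere 0 1)) (δ : ℝ) (hδ : 0 < δ) :
    ∃ P : ℂ → ℂ, Differentiable ℂ P ∧ ∀ z ∈ sphere (0:ℂ) 1,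
      v z ≤ (P z).re ∧ (P z).re ≤ v z + δ := by
  have : Fact (0 < 2 * π) := ⟨by positivity⟩
  let g : C(AddCircle (2 * π), ℂ) := ⟨fun x => (v (AddCircle.toCircle x : ℂ) : ℂ), by
    refine Complex.continuous_ofReal.comp ?_
    refine hv.comp_continuous (by fun_prop) ?_
    intro x; exact mem_sphere_zero_iff_norm.2 (Circle.norm_coe _)⟩
  have hg : g ∈ closure ((Submodule.span ℂ (range <| @fourier (2 * π))) : Set C(AddCircle (2 * π), ℂ)) := by
    rw [← Submodule.topologicalClosure_coe, span_fourier_closure_eq_top]; trivial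
  obtain ⟨h, hh, hd⟩ := Metric.mem_closure_iff.1 hg (δ / 2) (by positivity)
  obtain ⟨P, Q, hP, hQ, hPQ⟩ := hfv_trig h hh
  refine ⟨fun z => P z + Q z + ((δ / 2 : ℝ) : ℂ), (hP.add hQ).add_const _, fun z hz => ?_⟩
  have hz1 : ‖z‖ = 1 := by simpa using hz
  have hze : Complex.exp (z.arg * Complex.I) = z := by
    have := Complex.norm_mul_exp_arg_mul_I z
    rwa [hz1, Complex.ofReal_one, one_mul] at this
  have h1 : dist (g (z.arg : AddCircle (2 * π))) (h (z.arg : AddCircle (2 * π))) < δ / 2 :=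
    lt_of_le_of_lt (ContinuousMap.dist_apply_le_dist _) hd
  have h2 : g (z.arg : AddCircle (2 * π)) = (v z : ℂ) := by
    simp only [g, ContinuousMap.coe_mk, AddCircle.toCircle_apply_mk]
    rw [Circle.coe_exp, div_self (by positivity), one_mul, hze]
  rw [h2, hPQ, hze, dist_eq_norm] at h1
  have h3 := (Complex.abs_re_le_norm _).trans_lt h1
  rw [abs_lt] at h3
  simp only [Complex.sub_re, Complex.add_re, Complex.conj_re, Complex.ofReal_re] at h3 ⊢
  constructor <;> linarith [h3.1, h3.2]

/-- circle means of `|exp h|` are dominated by the mean over the unit circle -/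
lemma hfv_mean (h : ℂ → ℂ) (hh : Differentiable ℂ h) (ρ : ℝ) (h0 : 0 ≤ ρ) (h1 : ρ ≤ 1) :
    ∫ θ in (0:ℝ)..(2 * π), ‖Complex.exp (h ((ρ : ℂ) * Complex.exp (θ * Complex.I)))‖ ≤
    ∫ θ in (0:ℝ)..(2 * π), ‖Complex.exp (h (Complex.exp (θ * Complex.I)))‖ := by
  have hc := hh.continuous
  set G : ℂ → ℂ := fun z => Complex.exp (h z) with hG
  have hGd : Differentiable ℂ G := hh.cexp
  have hGc : Continuous G := hGd.continuous
  have hGd' : Continuous (deriv G) := (hGd.contDiff (n := 1)).continuous_deriv le_rfl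
  let c : ℝ → ℂ := fun θ => Complex.exp (-(((h ((ρ : ℂ) * Complex.exp (θ * Complex.I))).im : ℂ) * Complex.I))
  have hcc : Continuous c := by fun_prop
  have hcn : ∀ θ, ‖c θ‖ = 1 := by
    intro θ
    simp only [c, ← neg_mul, ← Complex.ofReal_neg, Complex.norm_exp_ofReal_mul_I]
  let w : ℂ → ℂ := fun ζ => ∫ θ in (0:ℝ)..(2 * π), G (ζ * Complex.exp (θ * Complex.I)) * c θ
  have hw : Differentiable ℂ w := by
    intro ζ
    obtain ⟨M, hM⟩ := ((isCompact_closedBall (0:ℂ) (‖ζ‖ + 1)).bddAbove_image hGd'.norm.continuousOn)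
    have := intervalIntegral.hasDerivAt_integral_of_dominated_loc_of_deriv_le (𝕜 := ℂ) (μ := volume)
      (a := 0) (b := 2 * π)
      (F := fun ζ (θ:ℝ) => G (ζ * Complex.exp (θ * Complex.I)) * c θ)
      (F' := fun ζ (θ:ℝ) => deriv G (ζ * Complex.exp (θ * Complex.I)) * Complex.exp (θ * Complex.I) * c θ)
      (x₀ := ζ) (s := ball ζ 1) (bound := fun _ => M) (ball_mem_nhds ζ one_pos)
      (Eventually.of_forall fun x => (by fun_prop : Continuous _).aestronglyMeasurable)
      ((by fun_prop : Continuous _).intervalIntegrable _ _)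
      ((by fun_prop : Continuous _).aestronglyMeasurable)
      (Eventually.of_forall fun θ _ x hx => ?_)
      (by simp)
      (Eventually.of_forall fun θ _ x hx => ?_)
    · exact this.2.differentiableAt
    · rw [norm_mul, norm_mul, hcn, Complex.norm_exp_ofReal_mul_I, mul_one, mul_one]
      refine hM ⟨_, ?_, rfl⟩
      rw [mem_closedBall_zero_iff, norm_mul, Complex.norm_exp_ofReal_mul_I, mul_one]
      rw [mem_ball, dist_eq_norm] at hx
      have := norm_le_norm_add_norm_sub ζ x
      rw [norm_sub_rev] at this
      linarith
    · have h2 : HasDerivAt (fun x : ℂ => x * Complex.exp (θ * Complex.I)) (Complex.exp (θ * Complex.I)) x := by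
        simpa using (hasDerivAt_id x).mul_const (Complex.exp (θ * Complex.I))
      exact ((hGd _).hasDerivAt.comp x h2).mul_const _
  have hbd : ∀ z ∈ frontier (ball (0:ℂ) 1), ‖w z‖ ≤
      ∫ θ in (0:ℝ)..(2 * π), ‖G (Complex.exp (θ * Complex.I))‖ := by
    intro z hz
    rw [frontier_ball _ one_ne_zero] at hz
    have hz1 : ‖z‖ = 1 := by simpa using hz
    have hze : Complex.exp (z.arg * Complex.I) = z := by
      have := Complex.norm_mul_exp_arg_mul_I z
      rwa [hz1, Complex.ofReal_one, one_mul] at this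
    have hper : Function.Periodic (fun θ : ℝ => ‖G (Complex.exp (θ * Complex.I))‖) (2 * π) := by
      intro θ
      simp only
      congr 2
      rw [Complex.ofReal_add, add_mul, Complex.exp_add]
      push_cast
      rw [Complex.exp_two_pi_mul_I, mul_one]
    calc ‖w z‖ ≤ ∫ θ in (0:ℝ)..(2 * π), ‖G (z * Complex.exp (θ * Complex.I)) * c θ‖ :=
          intervalIntegral.norm_integral_le_integral_norm (by positivity)
      _ = ∫ θ in (0:ℝ)..(2 * π), ‖G (Complex.exp (((θ + z.arg : ℝ) : ℂ) * Complex.I))‖ := by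
          congr 1; ext θ
          rw [norm_mul, hcn, mul_one]
          congr 2
          rw [Complex.ofReal_add, add_mul, Complex.exp_add, hze, mul_comm]
      _ = ∫ θ in (0:ℝ)..(2 * π), ‖G (Complex.exp (θ * Complex.I))‖ := by
          rw [intervalIntegral.integral_comp_add_right (fun θ : ℝ => ‖G (Complex.exp (θ * Complex.I))‖)]
          have := hper.intervalIntegral_add_eq z.arg 0
          rw [zero_add] at this ⊢
          rw [← this, add_comm]
  have hmax := Complex.norm_le_of_forall_mem_frontier_norm_le (U := ball (0:ℂ) 1) isBounded_ball
    hw.diffContOnCl hbd (z := (ρ : ℂ)) (by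
      rw [closure_ball _ one_ne_zero, mem_closedBall_zero_iff, Complex.norm_real, Real.norm_of_nonneg h0]
      exact h1)
  refine le_trans (le_of_eq ?_) hmax
  have : w ρ = ((∫ θ in (0:ℝ)..(2 * π), ‖Complex.exp (h ((ρ : ℂ) * Complex.exp (θ * Complex.I)))‖ : ℝ) : ℂ) := by
    rw [← intervalIntegral.integral_ofReal]
    simp only [w, G, c]
    congr 1; ext θ
    rw [← Complex.exp_add, Complex.norm_exp, Complex.ofReal_exp]
    congr 1
    linear_combination -Complex.re_add_im (h ((ρ : ℂ) * Complex.exp (θ * Complex.I)))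
  rw [this, Complex.norm_real, Real.norm_of_nonneg]
  exact intervalIntegral.integral_nonneg (by positivity) fun _ _ => norm_nonneg _

lemma hfv_point (G : ℂ → ℂ) (hG : Differentiable ℂ G) (z : ℂ) (ρ : ℝ) (h1 : ρ < 1) (hz : ‖z‖ ≤ ρ) :
    ‖G z‖ ≤ (1 - ρ)⁻¹ * (1 / (2 * π) * ∫ θ in (0:ℝ)..(2 * π), ‖G (Complex.exp (θ * Complex.I))‖) := by
  have hGc := hG.continuous
  have h := hG.diffContOnCl (s := ball (0:ℂ) 1) |>.two_pi_i_inv_smul_circleIntegral_sub_inv_smul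
    (w := z) (by rw [mem_ball_zero_iff]; linarith)
  rw [← h, norm_smul]
  have e1 : ‖(2 * π * Complex.I : ℂ)⁻¹‖ = 1 / (2 * π) := by
    simp [abs_of_pos Real.pi_pos]
  rw [e1, mul_left_comm, ← intervalIntegral.integral_const_mul]
  refine mul_le_mul_of_nonneg_left ?_ (by positivity)
  rw [circleIntegral]
  refine (intervalIntegral.norm_integral_le_integral_norm (by positivity)).trans ?_
  have key : ∀ θ : ℝ, 1 - ρ ≤ ‖Complex.exp (θ * Complex.I) - z‖ := by
    intro θ
    have := norm_sub_norm_le (Complex.exp (θ * Complex.I)) z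
    rw [Complex.norm_exp_ofReal_mul_I] at this
    linarith
  have key' : ∀ θ : ℝ, Complex.exp (θ * Complex.I) - z ≠ 0 := by
    intro θ h0
    have := key θ
    rw [h0, norm_zero] at this; linarith
  refine intervalIntegral.integral_mono_on (by positivity) ?_ ?_ ?_
  · apply Continuous.intervalIntegrable
    simp only [deriv_circleMap, circleMap, Complex.ofReal_one, one_mul, zero_add]
    have : Continuous fun θ : ℝ => (Complex.exp (θ * Complex.I) - z)⁻¹ :=
      Continuous.inv₀ (by fun_prop) key'
    fun_prop
  · apply Continuous.intervalIntegrable; fun_prop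
  · intro θ _
    simp only [deriv_circleMap, circleMap, Complex.ofReal_one, one_mul, zero_add, norm_smul, norm_mul,
      Complex.norm_exp_ofReal_mul_I, Complex.norm_I, one_mul, norm_inv]
    exact mul_le_mul_of_nonneg_right (inv_anti₀ (by linarith) (key θ)) (norm_nonneg _)

lemma hfv_montel (Fn : ℕ → ℂ → ℂ) (hd : ∀ n, DifferentiableOn ℂ (Fn n) (ball 0 1))
    (hb : ∀ ρ : ℝ, ρ < 1 → ∃ M : ℝ, ∀ n, ∀ z ∈ closedBall (0:ℂ) ρ, ‖Fn n z‖ ≤ M) :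
    ∃ F : ℂ → ℂ, DifferentiableOn ℂ F (ball 0 1) ∧ ∀ ρ : ℝ, ρ < 1 → ∃ n : ℕ → ℕ,
      Tendsto n atTop atTop ∧
      ∀ z ∈ closedBall (0:ℂ) ρ, Tendsto (fun k => Fn (n k) z) atTop (𝓝 (F z)) := by
  let U : Ultrafilter ℕ := Ultrafilter.of atTop
  have hU : (U : Filter ℕ) ≤ atTop := Ultrafilter.of_le atTop
  have hlim : ∀ z : ℂ, ∃ a : ℂ, z ∈ ball (0:ℂ) 1 → Tendsto (fun n => Fn n z) U (𝓝 a) := by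
    intro z
    by_cases hz : z ∈ ball (0:ℂ) 1
    · have hz' : ‖z‖ < 1 := by simpa using hz
      obtain ⟨M, hM⟩ := hb ‖z‖ hz'
      obtain ⟨a, -, ha⟩ := (isCompact_closedBall (0:ℂ) M).ultrafilter_le_nhds (U.map fun n => Fn n z)
        (by
          rw [le_principal_iff]
          change ∀ᶠ n in (U : Filter ℕ), Fn n z ∈ closedBall (0:ℂ) M
          exact Eventually.of_forall fun n => mem_closedBall_zero_iff.2 (hM n z (by simp)))
      exact ⟨a, fun _ => ha⟩
    · exact ⟨0, fun h => absurd h hz⟩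
  choose F hF using hlim
  have hloc : TendstoLocallyUniformlyOn Fn F U (ball 0 1) := by
    rw [Metric.tendstoLocallyUniformlyOn_iff]
    intro ε hε x hx
    have hx' : ‖x‖ < 1 := by simpa using hx
    set d := (1 - ‖x‖) / 2 with hdd
    have hd0 : 0 < d := by rw [hdd]; linarith
    obtain ⟨M, hM⟩ := hb (‖x‖ + d) (by rw [hdd]; linarith)
    have hM0 : 0 ≤ M := (norm_nonneg _).trans (hM 0 x (by simp [hd0.le]))
    have hsub : ball x d ⊆ closedBall (0:ℂ) (‖x‖ + d) := by
      intro y hy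
      rw [mem_ball, dist_eq_norm] at hy
      rw [mem_closedBall_zero_iff]
      have := norm_le_norm_add_norm_sub x y
      linarith [norm_sub_rev x y]
    have hsub' : ball x d ⊆ ball (0:ℂ) 1 := by
      refine hsub.trans (closedBall_subset_ball ?_)
      rw [hdd]; linarith
    have hL : ∀ n, ∀ y ∈ ball x d, dist (Fn n y) (Fn n x) ≤ (2 * M) / d * dist y x := by
      intro n y hy
      refine Complex.dist_le_div_mul_dist_of_mapsTo_ball ((hd n).mono hsub') ?_ hy
      intro w hw
      rw [mem_closedBall, dist_eq_norm]
      have := norm_sub_le (Fn n w) (Fn n x)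
      linarith [hM n w (hsub hw), hM n x (hsub (mem_ball_self hd0))]
    have hLF : ∀ y ∈ ball x d, dist (F y) (F x) ≤ (2 * M) / d * dist y x := by
      intro y hy
      exact le_of_tendsto ((hF y (hsub' hy)).dist (hF x hx)) (Eventually.of_forall fun n => hL n y hy)
    set L := 2 * M / d with hLdef
    have hL0 : 0 ≤ L := by positivity
    set η := min d (ε / (3 * (L + 1))) with hη
    have hη0 : 0 < η := lt_min hd0 (by positivity)
    refine ⟨ball x η, mem_nhdsWithin_of_mem_nhds (ball_mem_nhds x hη0), ?_⟩
    filter_upwards [Metric.tendsto_nhds.1 (hF x hx) (ε / 3) (by positivity)] with n hn y hy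
    have hyd : y ∈ ball x d := ball_subset_ball (min_le_left _ _) hy
    have h1 := hL n y hyd
    have h2 := hLF y hyd
    have h3 : L * dist y x ≤ ε / 3 := by
      have : dist y x ≤ ε / (3 * (L + 1)) := (mem_ball.1 hy).le.trans (min_le_right _ _)
      calc L * dist y x ≤ (L + 1) * (ε / (3 * (L + 1))) := by
            apply mul_le_mul _ this dist_nonneg <;> linarith
        _ = ε / 3 := by field_simp
    calc dist (F y) (Fn n y) ≤ dist (F y) (F x) + dist (F x) (Fn n x) + dist (Fn n x) (Fn n y) :=
          dist_triangle4 _ _ _ _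
      _ < ε := by
        rw [dist_comm (F x), dist_comm (Fn n x) (Fn n y)]
        linarith
  refine ⟨F, hloc.differentiableOn (Eventually.of_forall hd) isOpen_ball, fun ρ hρ => ?_⟩
  have hun : TendstoUniformlyOn Fn F U (closedBall 0 ρ) :=
    (tendstoLocallyUniformlyOn_iff_tendstoUniformlyOn_of_compact (isCompact_closedBall _ _)).1
      (hloc.mono (closedBall_subset_ball hρ))
  rw [Metric.tendstoUniformlyOn_iff] at hun
  have hex : ∀ k : ℕ, ∃ n, k ≤ n ∧ ∀ z ∈ closedBall (0:ℂ) ρ, dist (F z) (Fn n z) < 1 / ((k:ℝ) + 1) := by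
    intro k
    exact (((eventually_ge_atTop k).filter_mono hU).and (hun _ (by positivity))).exists
  choose n hn1 hn2 using hex
  refine ⟨n, tendsto_atTop_mono hn1 tendsto_id, fun z hz => ?_⟩
  rw [tendsto_iff_dist_tendsto_zero]
  refine squeeze_zero (fun _ => dist_nonneg) (fun k => ?_) tendsto_one_div_add_atTop_nhds_zero_nat
  rw [dist_comm]
  exact (hn2 k z hz).le

lemma hfv_circle_mem {r : ℝ} (hr : r ∈ Ioo (0:ℝ) 1) (θ : ℝ) :
    (r : ℂ) * Complex.exp (θ * Complex.I) ∈ ball (0:ℂ) 1 := by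
  rw [mem_ball_zero_iff, norm_mul, Complex.norm_exp_ofReal_mul_I, mul_one, Complex.norm_real,
    Real.norm_of_nonneg hr.1.le]
  exact hr.2

lemma hfv_circle_cont {B : Type*} [NormedAddCommGroup B]
    {f : ℂ → B} (hf : ContinuousOn f (ball (0 : ℂ) 1)) {r : ℝ} (hr : r ∈ Ioo (0:ℝ) 1)
    {p : ℝ} (hp : 0 ≤ p) :
    Continuous fun θ : ℝ => ‖f ((r : ℂ) * Complex.exp (θ * Complex.I))‖ ^ p := by
  have : Continuous fun θ : ℝ => f ((r : ℂ) * Complex.exp (θ * Complex.I)) :=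
    hf.comp_continuous (by fun_prop) (hfv_circle_mem hr)
  exact this.norm.rpow_const fun _ => Or.inr hp

lemma hfv_mono {B C : Type*} [NormedAddCommGroup B] [NormedAddCommGroup C]
    {f : ℂ → B} {g : ℂ → C} (hf : ContinuousOn f (ball (0 : ℂ) 1))
    (hg : ContinuousOn g (ball (0 : ℂ) 1)) (h : ∀ z ∈ ball (0:ℂ) 1, ‖f z‖ ≤ ‖g z‖) (p : ℝ≥0∞) :
    hardyNorm p f ≤ hardyNorm p g := by
  unfold hardyNorm
  split_ifs with hp
  · exact iSup₂_mono fun z hz => by exact_mod_cast h z hz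
  · refine iSup₂_mono fun r hr => ENNReal.ofReal_le_ofReal ?_
    refine Real.rpow_le_rpow ?_ ?_ (by positivity)
    · exact mul_nonneg (by positivity) (intervalIntegral.integral_nonneg (by positivity)
        fun _ _ => by positivity)
    · refine mul_le_mul_of_nonneg_left ?_ (by positivity)
      refine intervalIntegral.integral_mono_on (by positivity)
        ((hfv_circle_cont hf hr ENNReal.toReal_nonneg).intervalIntegrable _ _)
        ((hfv_circle_cont hg hr ENNReal.toReal_nonneg).intervalIntegrable _ _) fun θ _ => ?_
      exact Real.rpow_le_rpow (norm_nonneg _) (h _ (hfv_circle_mem hr θ)) ENNReal.toReal_nonneg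

lemma hfv_step {B : Type*} [NormedAddCommGroup B] [NormedSpace ℂ B]
    {f : ℂ → B} (hf : DifferentiableOn ℂ f (ball (0 : ℂ) 1)) {r : ℝ} (hr : r ∈ Ioo (0:ℝ) 1)
    {ε : ℝ} (hε : 0 < ε) :
    ∃ P : ℂ → ℂ, Differentiable ℂ P ∧
      (∀ z ∈ closedBall (0:ℂ) 1, ‖f (r * z)‖ ≤ ‖Complex.exp (P z)‖) ∧
      ∀ z ∈ sphere (0:ℂ) 1, ‖Complex.exp (P z)‖ ≤ Real.exp ε * max ‖f (r * z)‖ ε := by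
  have hmaps : MapsTo (fun z : ℂ => (r : ℂ) * z) (closedBall 0 1) (ball 0 1) := by
    intro z hz
    have hz' : ‖z‖ ≤ 1 := by simpa using hz
    rw [mem_ball_zero_iff, norm_mul, Complex.norm_real, Real.norm_of_nonneg hr.1.le]
    nlinarith [hr.1, hr.2]
  have hfr : DifferentiableOn ℂ (fun z : ℂ => f (r * z)) (closedBall 0 1) :=
    hf.comp (by fun_prop) hmaps
  have hpos : ∀ z, 0 < max ‖f (r * z)‖ ε := fun z => lt_max_of_lt_right hε
  obtain ⟨P, hP, hPv⟩ := hfv_approx (fun z => Real.log (max ‖f (r * z)‖ ε))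
    (ContinuousOn.log (ContinuousOn.sup (hfr.continuousOn.mono sphere_subset_closedBall).norm continuousOn_const)
      fun z _ => (hpos z).ne') ε hε
  refine ⟨P, hP, fun z hz => ?_, fun z hz => ?_⟩
  · have hd : DifferentiableOn ℂ (fun z => Complex.exp (-P z) • f (r * z)) (closedBall 0 1) :=
      (hP.neg.cexp.differentiableOn).smul hfr
    have := Complex.norm_le_of_forall_mem_frontier_norm_le (U := ball (0:ℂ) 1) isBounded_ball
      (f := fun z => Complex.exp (-P z) • f (r * z)) (C := 1)
      (by
        apply DifferentiableOn.diffContOnCl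
        rwa [closure_ball _ one_ne_zero])
      (by
        intro w hw
        rw [frontier_ball _ one_ne_zero] at hw
        have h1 := (hPv w hw).1
        rw [Real.log_le_iff_le_exp (hpos w)] at h1
        rw [norm_smul, Complex.exp_neg, norm_inv, Complex.norm_exp, inv_mul_le_iff₀ (Real.exp_pos _), mul_one]
        exact (le_max_left _ _).trans h1) (z := z) (by rwa [closure_ball _ one_ne_zero])
    rwa [norm_smul, Complex.exp_neg, norm_inv, inv_mul_le_iff₀ (by simp), mul_one] at this
  · have h2 := (hPv z hz).2
    rw [Complex.norm_exp]
    calc Real.exp (P z).re ≤ Real.exp (Real.log (max ‖f (r * z)‖ ε) + ε) := Real.exp_le_exp.2 h2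
      _ = _ := by rw [Real.exp_add, Real.exp_log (hpos z), mul_comm]

lemma hfv_quot {B : Type*} [NormedAddCommGroup B] [NormedSpace ℂ B] [CompleteSpace B]
    {f : ℂ → B} (hf : DifferentiableOn ℂ f (ball (0 : ℂ) 1)) {F : ℂ → ℂ}
    (hF : DifferentiableOn ℂ F (ball (0 : ℂ) 1)) (hle : ∀ z ∈ ball (0:ℂ) 1, ‖f z‖ ≤ ‖F z‖)
    (hfne : ∃ z ∈ ball (0 : ℂ) 1, f z ≠ 0) :
    ∃ φ : ℂ → B, DifferentiableOn ℂ φ (ball (0 : ℂ) 1) ∧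
      (∀ z ∈ ball (0 : ℂ) 1, f z = F z • φ z) ∧ (∀ z ∈ ball (0 : ℂ) 1, ‖φ z‖ ≤ 1) := by
  let g : ℂ → B := fun z => (F z)⁻¹ • f z
  let φ : ℂ → B := fun z => limUnder (𝓝[≠] z) g
  have hFa : AnalyticOnNhd ℂ F (ball 0 1) := hF.analyticOnNhd isOpen_ball
  have hne : ∀ c ∈ ball (0:ℂ) 1, ∀ᶠ z in 𝓝[≠] c, F z ≠ 0 := by
    intro c hc
    by_contra hcon
    have h0 := hFa.eqOn_zero_of_preconnected_of_frequently_eq_zero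
      (convex_ball (0:ℂ) 1).isPreconnected hc (by
        rw [Filter.Frequently]; exact hcon)
    obtain ⟨z, hz, hfz⟩ := hfne
    have := hle z hz
    rw [h0 hz] at this
    simp only [Pi.zero_apply, norm_zero, norm_le_zero_iff] at this
    exact hfz this
  have hgb : ∀ z ∈ ball (0:ℂ) 1, ‖g z‖ ≤ 1 := by
    intro z hz
    simp only [g, norm_smul, norm_inv]
    exact inv_mul_le_one_of_le₀ (hle z hz) (norm_nonneg _)
  have hgd : ∀ z ∈ ball (0:ℂ) 1, F z ≠ 0 → DifferentiableAt ℂ g z := by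
    intro z hz h0
    have hz' := isOpen_ball.mem_nhds hz
    exact ((hF.differentiableAt hz').inv h0).smul (hf.differentiableAt hz')
  have hφg : ∀ z ∈ ball (0:ℂ) 1, F z ≠ 0 → φ z = g z := by
    intro z hz h0
    exact ((hgd z hz h0).continuousAt.tendsto.mono_left nhdsWithin_le_nhds).limUnder_eq
  have hφd : DifferentiableOn ℂ φ (ball 0 1) := by
    intro c hc
    have hev : ∀ᶠ z in 𝓝 c, z ≠ c → F z ≠ 0 := eventually_nhdsWithin_iff.1 (hne c hc)
    set s : Set ℂ := {z | z ∈ ball (0:ℂ) 1 ∧ (z ≠ c → F z ≠ 0)} with hs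
    have hsn : s ∈ 𝓝 c := (isOpen_ball.mem_nhds hc |> fun h => inter_mem h hev)
    have hupd := Complex.differentiableOn_update_limUnder_of_bddAbove (f := g) hsn
      (fun z hz => (hgd z hz.1.1 (hz.1.2 hz.2)).differentiableWithinAt)
      ⟨1, by rintro _ ⟨z, hz, rfl⟩; exact hgb z hz.1.1⟩
    have heq : EqOn φ (Function.update g c (limUnder (𝓝[≠] c) g)) s := by
      intro z hz
      by_cases hzc : z = c
      · subst hzc; simp [φ]
      · rw [Function.update_of_ne hzc]; exact hφg z hz.1 (hz.2 hzc)
    exact ((hupd.congr heq).differentiableAt hsn).differentiableWithinAt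
  have hcl : ∀ c ∈ ball (0:ℂ) 1, ∀ᶠ z in 𝓝[≠] c, z ∈ ball (0:ℂ) 1 ∧ φ z = g z ∧ F z ≠ 0 := by
    intro c hc
    filter_upwards [hne c hc, nhdsWithin_le_nhds (isOpen_ball.mem_nhds hc)] with z h1 h2
    exact ⟨h2, hφg z h2 h1, h1⟩
  refine ⟨φ, hφd, fun c hc => ?_, fun c hc => ?_⟩
  · have hc' := isOpen_ball.mem_nhds hc
    have t1 : Tendsto f (𝓝[≠] c) (𝓝 (f c)) :=
      (hf.differentiableAt hc').continuousAt.tendsto.mono_left nhdsWithin_le_nhds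
    have t2 : Tendsto (fun z => F z • φ z) (𝓝[≠] c) (𝓝 (F c • φ c)) :=
      ((hF.differentiableAt hc').smul (hφd.differentiableAt hc')).continuousAt.tendsto.mono_left
        nhdsWithin_le_nhds
    refine tendsto_nhds_unique t1 (t2.congr' ?_)
    filter_upwards [hcl c hc] with z hz
    rw [hz.2.1]
    simp only [g]
    rw [smul_inv_smul₀ hz.2.2]
  · have hc' := isOpen_ball.mem_nhds hc
    have t2 : Tendsto (fun z => ‖φ z‖) (𝓝[≠] c) (𝓝 ‖φ c‖) :=
      (hφd.differentiableAt hc').continuousAt.norm.tendsto.mono_left nhdsWithin_le_nhds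
    refine le_of_tendsto t2 ?_
    filter_upwards [hcl c hc] with z hz
    rw [hz.2.1]
    exact hgb z hz.1

lemma hfv_core {B : Type*} [NormedAddCommGroup B] [NormedSpace ℂ B]
    (q : ℝ≥0∞) (hq : 1 ≤ q) {f : ℂ → B} (hf : DifferentiableOn ℂ f (ball (0 : ℂ) 1))
    (hfin : hardyNorm q f ≠ ∞) :
    ∃ F : ℂ → ℂ, DifferentiableOn ℂ F (ball (0 : ℂ) 1) ∧ (∀ z ∈ ball (0:ℂ) 1, ‖f z‖ ≤ ‖F z‖) ∧
      hardyNorm q F ≤ hardyNorm q f := by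
  let ε : ℕ → ℝ := fun n => 1 / ((n:ℝ) + 1)
  have hε0 : ∀ n, 0 < ε n := fun n => by positivity
  have hε1 : ∀ n, ε n ≤ 1 := fun n => by
    simp only [ε]; rw [div_le_one (by positivity)]; linarith [(Nat.cast_nonneg n : (0:ℝ) ≤ n)]
  have hεt : Tendsto ε atTop (𝓝 0) := tendsto_one_div_add_atTop_nhds_zero_nat
  let r : ℕ → ℝ := fun n => 1 - ε n / 2
  have hr : ∀ n, r n ∈ Ioo (0:ℝ) 1 := fun n =>
    ⟨by simp only [r]; linarith [hε1 n], by simp only [r]; linarith [hε0 n]⟩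
  have hrt : Tendsto r atTop (𝓝 1) := by
    simpa using (tendsto_const_nhds (x := (1:ℝ))).sub (hεt.div_const 2)
  choose P hP hP1 hP2 using fun n => hfv_step hf (hr n) (hε0 n)
  let Fn : ℕ → ℂ → ℂ := fun n z => Complex.exp (P n z)
  have hFd : ∀ n, Differentiable ℂ (Fn n) := fun n => (hP n).cexp
  -- the lower bound passes to the limit
  have hlow : ∀ (F : ℂ → ℂ) (n : ℕ → ℕ) (z : ℂ), z ∈ ball (0:ℂ) 1 → Tendsto n atTop atTop →
      Tendsto (fun k => Fn (n k) z) atTop (𝓝 (F z)) → ‖f z‖ ≤ ‖F z‖ := by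
    intro F n z hz hn hFz
    have t1 : Tendsto (fun k => (r (n k) : ℂ) * z) atTop (𝓝 z) := by
      have := ((Complex.continuous_ofReal.tendsto 1).comp (hrt.comp hn)).mul_const z
      simpa using this
    have t2 : Tendsto (fun k => ‖f ((r (n k) : ℂ) * z)‖) atTop (𝓝 ‖f z‖) :=
      ((hf.differentiableAt (isOpen_ball.mem_nhds hz)).continuousAt.tendsto.comp t1).norm
    exact le_of_tendsto_of_tendsto' t2 hFz.norm fun k => hP1 _ z (ball_subset_closedBall hz)
  set A := (hardyNorm q f).toReal with hA
  have hA0 : 0 ≤ A := ENNReal.toReal_nonneg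
  have hAe : ENNReal.ofReal A = hardyNorm q f := ENNReal.ofReal_toReal hfin
  have hez : Tendsto (fun n => Real.exp (ε n)) atTop (𝓝 1) := by
    have := (Real.continuous_exp.tendsto 0).comp hεt
    rwa [Real.exp_zero] at this
  by_cases hqt : q = ∞
  · have hfb : ∀ z ∈ ball (0:ℂ) 1, ‖f z‖ ≤ A := by
      intro z hz
      have : (‖f z‖₊ : ℝ≥0∞) ≤ hardyNorm q f := by
        rw [hardyNorm, if_pos hqt]
        exact le_iSup₂ (f := fun z (_ : z ∈ ball (0:ℂ) 1) => (‖f z‖₊ : ℝ≥0∞)) z hz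
      have := ENNReal.toReal_mono hfin this
      simpa using this
    have hFb : ∀ n, ∀ z ∈ closedBall (0:ℂ) 1, ‖Fn n z‖ ≤ Real.exp (ε n) * max A (ε n) := by
      intro n z hz
      refine Complex.norm_le_of_forall_mem_frontier_norm_le (U := ball (0:ℂ) 1) isBounded_ball
        (hFd n).diffContOnCl (fun w hw => ?_) (by rwa [closure_ball _ one_ne_zero])
      rw [frontier_ball _ one_ne_zero] at hw
      refine (hP2 n w hw).trans (mul_le_mul_of_nonneg_left (max_le_max_right _ (hfb _ ?_)) (Real.exp_pos _).le)
      have hw' : ‖w‖ = 1 := by simpa using hw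
      rw [mem_ball_zero_iff, norm_mul, Complex.norm_real, Real.norm_of_nonneg (hr n).1.le, hw', mul_one]
      exact (hr n).2
    obtain ⟨F, hF, hFt⟩ := hfv_montel Fn (fun n => (hFd n).differentiableOn) (fun ρ hρ =>
      ⟨Real.exp 1 * max A 1, fun n z hz => (hFb n z (closedBall_subset_closedBall hρ.le hz)).trans
        (mul_le_mul (Real.exp_le_exp.2 (hε1 n)) (max_le_max_left _ (hε1 n))
          (le_max_of_le_left hA0) (Real.exp_pos _).le)⟩)
    refine ⟨F, hF, fun z hz => ?_, ?_⟩
    · obtain ⟨n, hn, hnt⟩ := hFt ‖z‖ (by simpa using hz)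
      exact hlow F n z hz hn (hnt z (by simp))
    · conv_lhs => rw [hardyNorm, if_pos hqt]
      refine iSup₂_le fun z hz => ?_
      obtain ⟨n, hn, hnt⟩ := hFt ‖z‖ (by simpa using hz)
      have t2 : Tendsto (fun k => Real.exp (ε (n k)) * max A (ε (n k))) atTop (𝓝 (1 * max A 0)) :=
        (hez.comp hn).mul ((tendsto_const_nhds.max hεt).comp hn)
      rw [one_mul, max_eq_left hA0] at t2
      have := le_of_tendsto_of_tendsto' (hnt z (by simp)).norm t2
        fun k => hFb _ z (ball_subset_closedBall hz)
      rw [← hAe]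
      rw [← enorm_eq_nnnorm, ← ofReal_norm]
      exact ENNReal.ofReal_le_ofReal this
  · set p := q.toReal with hp
    have hp1 : 1 ≤ p := by
      have := ENNReal.toReal_mono hqt hq
      simpa using this
    have hp0 : 0 < p := by linarith
    let m : (ℂ → ℂ) → ℝ → ℝ := fun G ρ => (1 / (2 * π)) * ∫ θ in (0:ℝ)..(2 * π),
      ‖G ((ρ : ℂ) * Complex.exp (θ * Complex.I))‖ ^ p
    have hfb : ∀ ρ ∈ Ioo (0:ℝ) 1, (1 / (2 * π)) * ∫ θ in (0:ℝ)..(2 * π),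
        ‖f ((ρ : ℂ) * Complex.exp (θ * Complex.I))‖ ^ p ≤ A ^ p := by
      intro ρ hρ
      have h0 : 0 ≤ (1 / (2 * π)) * ∫ θ in (0:ℝ)..(2 * π),
        ‖f ((ρ : ℂ) * Complex.exp (θ * Complex.I))‖ ^ p :=
        mul_nonneg (by positivity) (intervalIntegral.integral_nonneg (by positivity)
          fun _ _ => by positivity)
      have h1 : ENNReal.ofReal (((1 / (2 * π)) * ∫ θ in (0:ℝ)..(2 * π),
        ‖f ((ρ : ℂ) * Complex.exp (θ * Complex.I))‖ ^ p) ^ (1 / p)) ≤ ENNReal.ofReal A := by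
        rw [hAe, hardyNorm, if_neg hqt]
        exact le_iSup₂ (f := fun (r : ℝ) (_ : r ∈ Ioo (0:ℝ) 1) => ENNReal.ofReal
          (((1 / (2 * π)) * ∫ θ in (0:ℝ)..(2 * π),
          ‖f ((r : ℂ) * Complex.exp (θ * Complex.I))‖ ^ q.toReal) ^ (1 / q.toReal))) ρ hρ
      rw [ENNReal.ofReal_le_ofReal_iff hA0] at h1
      rwa [one_div p, Real.rpow_inv_le_iff_of_pos h0 hA0 hp0] at h1
    have hnp : ∀ n z, ‖Fn n z‖ ^ p = ‖Complex.exp ((p : ℂ) * P n z)‖ := by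
      intro n z
      simp only [Fn, Complex.norm_exp, ← Real.exp_mul]
      congr 1
      simp [mul_comm]
    -- mean over the unit circle
    have hone : ∀ n, (1 / (2 * π)) * ∫ θ in (0:ℝ)..(2 * π),
        ‖Complex.exp ((p : ℂ) * P n (Complex.exp (θ * Complex.I)))‖ ≤
        Real.exp (ε n) ^ p * (A ^ p + ε n ^ p) := by
      intro n
      have hcont := hfv_circle_cont hf.continuousOn (hr n) hp0.le
      have h1 : ∫ θ in (0:ℝ)..(2 * π), ‖Complex.exp ((p : ℂ) * P n (Complex.exp (θ * Complex.I)))‖ ≤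
          ∫ θ in (0:ℝ)..(2 * π), Real.exp (ε n) ^ p *
            (‖f ((r n : ℂ) * Complex.exp (θ * Complex.I))‖ ^ p + ε n ^ p) := by
        have hPc := (hP n).continuous
        refine intervalIntegral.integral_mono_on (by positivity)
          ((by fun_prop : Continuous _).intervalIntegrable _ _)
          ((by fun_prop : Continuous _).intervalIntegrable _ _) fun θ _ => ?_
        rw [← hnp]
        have h2 := hP2 n (Complex.exp (θ * Complex.I)) (by
          rw [mem_sphere_zero_iff_norm, Complex.norm_exp_ofReal_mul_I])
        refine (Real.rpow_le_rpow (norm_nonneg _) h2 hp0.le).trans ?_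
        rw [Real.mul_rpow (Real.exp_pos _).le (le_max_of_le_right (hε0 n).le)]
        refine mul_le_mul_of_nonneg_left ?_ (by positivity)
        have a1 : 0 ≤ ‖f ((r n : ℂ) * Complex.exp (θ * Complex.I))‖ ^ p := by positivity
        have a2 : 0 ≤ ε n ^ p := Real.rpow_nonneg (hε0 n).le _
        rcases max_choice ‖f ((r n : ℂ) * Complex.exp (θ * Complex.I))‖ (ε n) with h | h <;> rw [h] <;>
          linarith
      rw [intervalIntegral.integral_const_mul, intervalIntegral.integral_add
        (hcont.intervalIntegrable _ _) (by simp), intervalIntegral.integral_const] at h1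
      have h3 := hfb (r n) (hr n)
      calc _ ≤ _ := mul_le_mul_of_nonneg_left h1 (by positivity : 0 ≤ 1 / (2 * π))
        _ = Real.exp (ε n) ^ p * ((1 / (2 * π)) * (∫ θ in (0:ℝ)..(2 * π),
              ‖f ((r n : ℂ) * Complex.exp (θ * Complex.I))‖ ^ p) + ε n ^ p) := by
            rw [smul_eq_mul, sub_zero]
            generalize (∫ θ in (0:ℝ)..(2 * π),
              ‖f ((r n : ℂ) * Complex.exp (θ * Complex.I))‖ ^ p) = X
            field_simp
        _ ≤ _ := by gcongr
    have hdp : ∀ n, Differentiable ℂ fun z => (p : ℂ) * P n z := fun n => (hP n).const_mul _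
    have hmean : ∀ n, ∀ ρ ∈ Ioo (0:ℝ) 1, m (Fn n) ρ ≤ Real.exp (ε n) ^ p * (A ^ p + ε n ^ p) := by
      intro n ρ hρ
      refine le_trans ?_ (hone n)
      simp only [m, hnp]
      exact mul_le_mul_of_nonneg_left (hfv_mean _ (hdp n) ρ hρ.1.le hρ.2.le) (by positivity)
    have hbound : ∀ ρ : ℝ, ρ < 1 → ∃ M : ℝ, ∀ n, ∀ z ∈ closedBall (0:ℂ) ρ, ‖Fn n z‖ ≤ M := by
      intro ρ hρ
      refine ⟨1 + (1 - ρ)⁻¹ * (Real.exp 1 ^ p * (A ^ p + 1)), fun n z hz => ?_⟩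
      have h1 := hfv_point _ (hdp n).cexp z ρ hρ (by simpa using hz)
      rw [← hnp] at h1
      have hi : 0 ≤ (1 - ρ)⁻¹ := inv_nonneg.2 (by linarith)
      have h2 : ‖Fn n z‖ ^ p ≤ (1 - ρ)⁻¹ * (Real.exp 1 ^ p * (A ^ p + 1)) := by
        refine h1.trans (mul_le_mul_of_nonneg_left ((hone n).trans ?_) hi)
        have b1 : ε n ^ p ≤ 1 := Real.rpow_le_one (hε0 n).le (hε1 n) hp0.le
        have b2 : 0 ≤ A ^ p := Real.rpow_nonneg hA0 _
        have b3 : Real.exp (ε n) ^ p ≤ Real.exp 1 ^ p :=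
          Real.rpow_le_rpow (Real.exp_pos _).le (Real.exp_le_exp.2 (hε1 n)) hp0.le
        have b4 : 0 ≤ ε n ^ p := Real.rpow_nonneg (hε0 n).le _
        exact mul_le_mul b3 (by linarith) (by linarith) (by positivity)
      have h3 : ‖Fn n z‖ ≤ 1 + ‖Fn n z‖ ^ p := by
        rcases le_total ‖Fn n z‖ 1 with h | h
        · linarith [Real.rpow_nonneg (norm_nonneg (Fn n z)) p]
        · have := Real.rpow_le_rpow_of_exponent_le h hp1
          rw [Real.rpow_one] at this
          linarith
      linarith
    obtain ⟨F, hF, hFt⟩ := hfv_montel Fn (fun n => (hFd n).differentiableOn) hbound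
    refine ⟨F, hF, fun z hz => ?_, ?_⟩
    · obtain ⟨n, hn, hnt⟩ := hFt ‖z‖ (by simpa using hz)
      exact hlow F n z hz hn (hnt z (by simp))
    · conv_lhs => rw [hardyNorm, if_neg hqt]
      refine iSup₂_le fun ρ hρ => ?_
      rw [← hAe]
      refine ENNReal.ofReal_le_ofReal ?_
      change (m F ρ) ^ (1 / p) ≤ A
      have hm0 : 0 ≤ m F ρ := mul_nonneg (by positivity)
        (intervalIntegral.integral_nonneg (by positivity) fun _ _ => by positivity)
      rw [one_div p, Real.rpow_inv_le_iff_of_pos hm0 hA0 hp0]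
      obtain ⟨n, hn, hnt⟩ := hFt ρ hρ.2
      obtain ⟨M, hM⟩ := hbound ρ hρ.2
      have hmem : ∀ θ : ℝ, (ρ : ℂ) * Complex.exp (θ * Complex.I) ∈ closedBall (0:ℂ) ρ := by
        intro θ
        rw [mem_closedBall_zero_iff, norm_mul, Complex.norm_exp_ofReal_mul_I, mul_one,
          Complex.norm_real, Real.norm_of_nonneg hρ.1.le]
      have t1 : Tendsto (fun k => m (Fn (n k)) ρ) atTop (𝓝 (m F ρ)) := by
        refine Tendsto.const_mul _ ?_
        refine intervalIntegral.tendsto_integral_filter_of_dominated_convergence (fun _ => M ^ p)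
          (Eventually.of_forall fun k =>
            (hfv_circle_cont (hFd _).continuous.continuousOn hρ hp0.le).aestronglyMeasurable)
          (Eventually.of_forall fun k => Eventually.of_forall fun θ _ => ?_) (by simp)
          (Eventually.of_forall fun θ _ => ?_)
        · rw [Real.norm_of_nonneg (by positivity)]
          exact Real.rpow_le_rpow (norm_nonneg _) (hM _ _ (hmem θ)) hp0.le
        · exact (hnt _ (hmem θ)).norm.rpow_const (Or.inr hp0.le)
      have t2 : Tendsto (fun k => Real.exp (ε (n k)) ^ p * (A ^ p + ε (n k) ^ p)) atTop
          (𝓝 (1 ^ p * (A ^ p + 0 ^ p))) :=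
        ((hez.comp hn).rpow_const (Or.inr hp0.le)).mul
          (tendsto_const_nhds.add ((hεt.comp hn).rpow_const (Or.inr hp0.le)))
      rw [Real.one_rpow, Real.zero_rpow hp0.ne', add_zero, one_mul] at t2
      exact le_of_tendsto_of_tendsto' t1 t2 fun k => hmean _ ρ hρ

/-- Let `1 ≤ q, s, r ≤ ∞` with `1/q = 1/r + 1/s` and let `B` be a Banach space.  Every `f` in
the unit ball of `H^q(B)` (nonzero, so that `log‖f‖` is integrable on circles) factors as
`f = F·φ` with `F` scalar analytic on the disc whose boundary modulus equals `‖f‖_B`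
(so `‖F‖_{H^q} = ‖f‖_{H^q(B)} ≤ 1`) and `φ` analytic `B`-valued with `‖φ‖ ≤ 1` on the disc.
In particular, if `f ∈ H¹(B)` then `K_t(f, H¹(B), H^∞(B)) ≤ K_t(F, H¹, H^∞)` for all `t > 0`. -/
theorem hardy_factorization_vector_valued
    {B : Type*} [NormedAddCommGroup B] [NormedSpace ℂ B] [CompleteSpace B]
    (q s r : ℝ≥0∞) (hq : 1 ≤ q) (hs : 1 ≤ s) (hr : 1 ≤ r) (hqsr : q⁻¹ = r⁻¹ + s⁻¹)
    (f : ℂ → B) (hf : DifferentiableOn ℂ f (ball (0 : ℂ) 1))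
    (hfball : hardyNorm q f ≤ 1) (hfne : ∃ z ∈ ball (0 : ℂ) 1, f z ≠ 0) :
    ∃ F : ℂ → ℂ, ∃ φ : ℂ → B,
      DifferentiableOn ℂ F (ball (0 : ℂ) 1) ∧ DifferentiableOn ℂ φ (ball (0 : ℂ) 1) ∧
      (∀ z ∈ ball (0 : ℂ) 1, f z = F z • φ z) ∧
      (∀ z ∈ ball (0 : ℂ) 1, ‖φ z‖ ≤ 1) ∧
      hardyNorm q F = hardyNorm q f ∧ hardyNorm q F ≤ 1 ∧
      (hardyNorm 1 f < ∞ →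
        ∀ t : ℝ, 0 < t → KHdisc t 1 ∞ f ≤ KHdisc t 1 ∞ F) := by
  have hfin : hardyNorm q f ≠ ∞ := (hfball.trans_lt ENNReal.one_lt_top).ne
  obtain ⟨F, hF, hle, hnorm⟩ := hfv_core q hq hf hfin
  obtain ⟨φ, hφ, hfac, hφ1⟩ := hfv_quot hf hF hle hfne
  refine ⟨F, φ, hF, hφ, hfac, hφ1,
    le_antisymm hnorm (hfv_mono hf.continuousOn hF.continuousOn hle q), hnorm.trans hfball, ?_⟩
  intro _ t _
  have hsm : ∀ g : ℂ → ℂ, DifferentiableOn ℂ g (ball (0 : ℂ) 1) → ∀ p : ℝ≥0∞,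
      hardyNorm p (fun z => g z • φ z) ≤ hardyNorm p g := by
    intro g hg p
    refine hfv_mono (hg.smul hφ).continuousOn hg.continuousOn (fun z hz => ?_) p
    change ‖g z • φ z‖ ≤ ‖g z‖
    rw [norm_smul]
    exact mul_le_of_le_one_right (norm_nonneg _) (hφ1 z hz)
  refine le_sInf ?_
  rintro c ⟨f₀, f₁, hsum, hd₀, hd₁, hn₀, hn₁, rfl⟩
  refine le_trans (sInf_le ⟨fun z => f₀ z • φ z, fun z => f₁ z • φ z, fun z hz => ?_,
    hd₀.smul hφ, hd₁.smul hφ, (hsm f₀ hd₀ 1).trans_lt hn₀, (hsm f₁ hd₁ ∞).trans_lt hn₁, rfl⟩) ?_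
  · rw [hfac z hz, hsum z hz, add_smul]
  · gcongr
    · exact hsm f₀ hd₀ 1
    · exact hsm f₁ hd₁ ∞
end
end
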